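/- Let N ≥ 1, p > 1, m ≥ 1, q > max(p+m−2, 1), and let f, a be as in the setting. Suppose V(x,t) ≥ h(x) for a.e. (x,t) ∈ S, where h : ℝ^N → ℝ is measurable and satisfies, for some constants α, σ1, σ2 ≥ 0 and C > 0: C^{−1}(1+|x|)^{−α} ≤ h(x) ≤ C(1+|x|)^{α} a.e., and for all sufficiently large R: ∫_{B_R} h^{−1/(q−1)} dμ_a ≤ C R^{σ1}(log R)^{1/(q−1)} and ∫_{B_R} h^{−(p+m−2)/(q−p−m+2)} dμ_a ≤ C R^{σ2}(log R)^{(p+m−2)/(q−p−m+2)}. Assume further: (i) 0 ≤ σ2 < pq/(q−p−m+2); (ii) σ1 ≤ (1/(q−1))·(pq/(q−p−m+2) − σ2). Then every global nonnegative weak solution of ∂_t u ≥ (1/a) div(a u^{m−1} |∇u|^{p−2} f(|∇u|) ∇u) + V u^q on S is zero a.e. (Euclidean specialization of the paper's Corollary 1.11.) -/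

import Mathlib

open MeasureTheory Real Set Metric
open scoped ENNReal RealInnerProductSpace

noncomputable section

/-- Euclidean space `ℝ^N`. -/
abbrev Euc (N : ℕ) : Type := EuclideanSpace ℝ (Fin N)

/-- The parabolic slab `S = ℝ^N × (0,∞)`. -/
def Sset (N : ℕ) : Set (Euc N × ℝ) := {z : Euc N × ℝ | 0 < z.2}

/-- The weighted measure `μ_a = a(x) dx` on `ℝ^N`. -/
def muA {N : ℕ} (a : Euc N → ℝ) : Measure (Euc N) :=
  (volume : Measure (Euc N)).withDensity (fun x => ENNReal.ofReal (a x))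

/-- The measure `dμ_a dt` on `ℝ^N × (0,∞)`. -/
def muS {N : ℕ} (a : Euc N → ℝ) : Measure (Euc N × ℝ) :=
  (muA a).prod ((volume : Measure ℝ).restrict (Set.Ioi (0 : ℝ)))

/-- The continuous linear functional `(w, τ) ↦ ⟪v, w⟫ + c·τ` on `ℝ^N × ℝ`,
encoding a space-time differential with spatial gradient `v` and time derivative `c`. -/
def pairCLM {N : ℕ} (v : Euc N) (c : ℝ) : (Euc N × ℝ) →L[ℝ] ℝ :=
  ((innerSL ℝ v).comp (ContinuousLinearMap.fst ℝ (Euc N) ℝ)) +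
    c • (ContinuousLinearMap.snd ℝ (Euc N) ℝ)

/-- `u` is a global nonnegative weak solution of
`∂ₜ u ≥ (1/a) div(a u^{m-1} |∇u|^{p-2} f(|∇u|) ∇u) + V u^q` on `S = ℝ^N × (0,∞)`,
where `gu`, `ut` are a.e. representatives of the spatial gradient and the time
derivative of `u`. -/
structure IsWeakSol (N : ℕ) (p m q : ℝ) (V : Euc N × ℝ → ℝ) (f : ℝ → ℝ)
    (a : Euc N → ℝ) (u : Euc N × ℝ → ℝ) (gu : Euc N × ℝ → Euc N)
    (ut : Euc N × ℝ → ℝ) : Prop where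
  nonneg : ∀ z ∈ Sset N, 0 ≤ u z
  locLip : LocallyLipschitzOn (Sset N) u
  deriv_ae : ∀ᵐ z ∂ ((volume : Measure (Euc N × ℝ)).restrict (Sset N)),
      DifferentiableAt ℝ u z → HasFDerivAt u (pairCLM (gu z) (ut z)) z
  int_uqV : LocallyIntegrableOn (fun z => u z ^ q * V z) (Sset N) (muS a)
  int_upm : LocallyIntegrableOn (fun z => u z ^ (p + m - 1)) (Sset N) (muS a)
  int_gu : LocallyIntegrableOn (fun z => ‖gu z‖ ^ p * u z ^ (m - 1)) (Sset N) (muS a)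
  int_ut : LocallyIntegrableOn (fun z => u z * ut z) (Sset N) (muS a)
  weak_ineq : ∀ (ψ : Euc N × ℝ → ℝ) (gψ : Euc N × ℝ → Euc N) (tψ : Euc N × ℝ → ℝ),
      (∀ z, 0 ≤ ψ z) → LocallyLipschitz ψ → HasCompactSupport ψ →
      tsupport ψ ⊆ Sset N →
      (∀ᵐ z ∂ (volume : Measure (Euc N × ℝ)),
        DifferentiableAt ℝ ψ z → HasFDerivAt ψ (pairCLM (gψ z) (tψ z)) z) →
      ∫ z, ψ z * u z ^ q * V z ∂ muS a ≤
        (∫ z, ⟪gψ z, gu z⟫ * u z ^ (m - 1) * ‖gu z‖ ^ (p - 2) * f ‖gu z‖ ∂ muS a)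
          - ∫ z, tψ z * u z ∂ muS a

/-- The region `E_R = {(x,t) ∈ S : |x|^θ2 + t^θ1 ≤ R^θ2}`. -/
def ESet (N : ℕ) (θ1 θ2 R : ℝ) : Set (Euc N × ℝ) :=
  {z ∈ Sset N | ‖z.1‖ ^ θ2 + z.2 ^ θ1 ≤ R ^ θ2}

/-- The time cutoff `χ_β`. -/
def chi (β t : ℝ) : ℝ := min 1 (max 0 (t / β - 1))

/-- Scaled Young inequality with conjugate exponents `q / b` and `q / (q - b)`. -/
lemma rpow_mul_le_scaled_young {b q X Y lam : ℝ} (hb : 0 < b) (hbq : b < q) (hX : 0 ≤ X)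
    (hY : 0 ≤ Y) (hlam : 0 < lam) :
    X ^ (b / q) * Y ≤ lam * X + lam ^ (-(b / (q - b))) * Y ^ (q / (q - b)) := by
  have hq : 0 < q := hb.trans hbq
  have hd : 0 < q - b := sub_pos.2 hbq
  rcases le_or_gt Y (lam * X ^ ((q - b) / q)) with hle | hlt
  · have h1 : X ^ (b / q) * X ^ ((q - b) / q) = X := by
      rw [← Real.rpow_add_of_nonneg hX (by positivity) (by positivity), ← add_div]
      simp [hq.ne']
    calc X ^ (b / q) * Y ≤ X ^ (b / q) * (lam * X ^ ((q - b) / q)) := by gcongr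
      _ = lam * X := by rw [mul_left_comm, h1]
      _ ≤ _ := le_add_of_nonneg_right (by positivity)
  · have h0 : X ^ ((q - b) / q) ≤ Y / lam := by rw [le_div_iff₀ hlam]; linarith
    have h1 : X ^ (b / q) ≤ (Y / lam) ^ (b / (q - b)) := by
      have : X ^ (b / q) = (X ^ ((q - b) / q)) ^ (b / (q - b)) := by
        rw [← Real.rpow_mul hX]; congr 1; field_simp
      rw [this]; gcongr
    have h2 : (Y / lam) ^ (b / (q - b)) * Y
        = lam ^ (-(b / (q - b))) * Y ^ (q / (q - b)) := by
      rw [Real.div_rpow hY hlam.le, Real.rpow_neg hlam.le]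
      have : Y ^ (q / (q - b)) = Y ^ (b / (q - b)) * Y := by
        have hne : q / (q - b) = b / (q - b) + 1 := by field_simp; ring
        rw [hne, Real.rpow_add_of_nonneg hY (by positivity) zero_le_one, Real.rpow_one]
      rw [this]; ring
    calc X ^ (b / q) * Y ≤ (Y / lam) ^ (b / (q - b)) * Y := by gcongr
      _ = _ := h2
      _ ≤ _ := le_add_of_nonneg_left (by positivity)

/-- Young absorption of a lower-order cutoff term into `H * w ^ q`. -/
lemma cutoff_mul_rpow_le {b q c e φ H w lam s : ℝ} (hb : 0 < b) (hbq : b < q) (hc : 0 ≤ c)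
    (hφ : 0 ≤ φ) (hφ1 : φ ≤ 1) (hH : 0 < H) (hw : 0 ≤ w) (hlam : 0 < lam) (hs : 0 ≤ s)
    (he : s * (b / q) ≤ e) :
    c * φ ^ e * w ^ b ≤ lam * (H * w ^ q * φ ^ s)
      + lam ^ (-(b / (q - b))) * (c ^ (q / (q - b)) * H ^ (-(b / (q - b)))) := by
  have hq : 0 < q := hb.trans hbq
  have hd : 0 < q - b := sub_pos.2 hbq
  have key := rpow_mul_le_scaled_young (X := H * w ^ q * φ ^ s) (Y := c * H ^ (-(b / q))) hb hbq
    (by positivity) (by positivity) hlam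
  have h1 : (c * H ^ (-(b / q))) ^ (q / (q - b)) = c ^ (q / (q - b)) * H ^ (-(b / (q - b))) := by
    rw [Real.mul_rpow hc (by positivity), ← Real.rpow_mul hH.le]
    congr 2; field_simp
  have h2 : (H * w ^ q * φ ^ s) ^ (b / q) * (c * H ^ (-(b / q))) = c * φ ^ (s * (b / q)) * w ^ b := by
    rw [Real.mul_rpow (by positivity) (by positivity), Real.mul_rpow hH.le (by positivity),
      ← Real.rpow_mul hφ, ← Real.rpow_mul hw, mul_div_cancel₀ b hq.ne', Real.rpow_neg hH.le]
    field_simp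
  rw [h1, h2] at key
  refine le_trans ?_ key
  gcongr c * ?_ * w ^ b
  rcases hφ.eq_or_lt with rfl | hφ0
  · rcases (show 0 ≤ s * (b / q) by positivity).eq_or_lt with h0 | h0
    · rw [← h0, Real.rpow_zero]
      exact Real.rpow_le_one le_rfl zero_le_one (h0 ▸ he)
    · rw [Real.zero_rpow (h0.trans_le he).ne']; positivity
  · exact Real.rpow_le_rpow_of_exponent_ge hφ0 hφ1 he

/-- Pointwise bound for the flux tested against `φ ^ s * w ^ (-σ)`, after absorbing the
gradient of the solution. -/
lemma flux_le {E : Type*} [NormedAddCommGroup E] [InnerProductSpace ℝ E]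
    {p m σ K φ u w g : ℝ} {s : ℕ} (v z : E) (hp : 1 < p) (hm : 1 ≤ m) (hσ : 0 < σ)
    (hφ : 0 ≤ φ) (hs : 2 ≤ s) (hu : 0 ≤ u) (huw : u ≤ w) (hw : 0 < w)
    (hg : 0 ≤ g) (hgK : g ≤ K) :
    ⟪(s * φ ^ (s - 1) * w ^ (-σ)) • v - (σ * φ ^ s * w ^ (-σ - 1)) • z, z⟫ * u ^ (m - 1)
        * ‖z‖ ^ (p - 2) * g
      ≤ K * s ^ p * σ ^ (-(p - 1)) * ‖v‖ ^ p * φ ^ ((s : ℝ) - p) * w ^ (p + m - 2) * w ^ (-σ) := by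
  have hK : 0 ≤ K := hg.trans hgK
  have hRHS : 0 ≤ K * s ^ p * σ ^ (-(p - 1)) * ‖v‖ ^ p * φ ^ ((s : ℝ) - p) * w ^ (p + m - 2)
      * w ^ (-σ) := by positivity
  rcases hφ.eq_or_lt with rfl | hφ0
  · refine le_trans (le_of_eq ?_) hRHS
    simp [show s - 1 ≠ 0 by omega, show s ≠ 0 by omega]
  rcases eq_or_ne z 0 with rfl | hz
  · simpa using hRHS
  have hz0 : 0 < ‖z‖ := norm_pos_iff.2 hz
  set Y : ℝ := s * ‖v‖ / φ with hY
  have hY0 : 0 ≤ Y := by positivity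
  have hinner : ⟪(s * φ ^ (s - 1) * w ^ (-σ)) • v - (σ * φ ^ s * w ^ (-σ - 1)) • z, z⟫
      ≤ φ ^ s * w ^ (-σ) * (Y * ‖z‖ - σ * ‖z‖ ^ 2 / w) := by
    rw [inner_sub_left, real_inner_smul_left, real_inner_smul_left, real_inner_self_eq_norm_sq]
    have h1 : ⟪v, z⟫ ≤ ‖v‖ * ‖z‖ := real_inner_le_norm v z
    have h2 : φ ^ s * Y = s * φ ^ (s - 1) * ‖v‖ := by
      rw [hY, show s = (s - 1) + 1 by omega, pow_succ]; simp; field_simp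
    have h3 : w ^ (-σ - 1) = w ^ (-σ) / w := Real.rpow_sub_one hw.ne' _
    calc s * φ ^ (s - 1) * w ^ (-σ) * ⟪v, z⟫ - σ * φ ^ s * w ^ (-σ - 1) * ‖z‖ ^ 2
        ≤ s * φ ^ (s - 1) * w ^ (-σ) * (‖v‖ * ‖z‖) - σ * φ ^ s * w ^ (-σ - 1) * ‖z‖ ^ 2 := by
          gcongr
      _ = w ^ (-σ) * (φ ^ s * Y) * ‖z‖ - σ * φ ^ s * w ^ (-σ - 1) * ‖z‖ ^ 2 := by rw [h2]; ring
      _ = _ := by rw [h3]; ring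
  have hmax : (Y * ‖z‖ - σ * ‖z‖ ^ 2 / w) * ‖z‖ ^ (p - 2) ≤ Y ^ p * w ^ (p - 1) * σ ^ (-(p - 1)) := by
    have e1 : ‖z‖ ^ (p - 1) = ‖z‖ * ‖z‖ ^ (p - 2) := by
      rw [show p - 1 = 1 + (p - 2) by ring, Real.rpow_add hz0, Real.rpow_one]
    have e2 : (Y * ‖z‖ - σ * ‖z‖ ^ 2 / w) * ‖z‖ ^ (p - 2) = (Y - σ * ‖z‖ / w) * ‖z‖ ^ (p - 1) := by
      rw [e1]; ring
    rw [e2]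
    rcases le_or_gt Y (σ * ‖z‖ / w) with hle | hlt
    · exact (mul_nonpos_of_nonpos_of_nonneg (by linarith) (by positivity)).trans (by positivity)
    · have h4 : ‖z‖ ≤ Y * w / σ := by
        rw [le_div_iff₀ hσ]; rw [div_lt_iff₀ hw] at hlt; linarith
      have hYpos : 0 < Y := lt_of_le_of_lt (by positivity) hlt
      calc (Y - σ * ‖z‖ / w) * ‖z‖ ^ (p - 1) ≤ Y * (Y * w / σ) ^ (p - 1) := by
            have : 0 ≤ σ * ‖z‖ / w := by positivity
            gcongr
            linarith
        _ = _ := by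
            rw [Real.div_rpow (by positivity) hσ.le, Real.mul_rpow hY0 hw.le, Real.rpow_neg hσ.le]
            have : Y ^ p = Y * Y ^ (p - 1) := by
              rw [show p = 1 + (p - 1) by ring, Real.rpow_add hYpos, Real.rpow_one]; simp
            rw [this]; ring
  have hum : u ^ (m - 1) ≤ w ^ (m - 1) := Real.rpow_le_rpow hu huw (by linarith)
  have hYp : φ ^ s * Y ^ p = s ^ p * ‖v‖ ^ p * φ ^ ((s : ℝ) - p) := by
    rw [hY, Real.div_rpow (by positivity) hφ0.le, Real.mul_rpow (by positivity) (by positivity),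
      Real.rpow_sub hφ0, Real.rpow_natCast]
    ring
  calc ⟪(s * φ ^ (s - 1) * w ^ (-σ)) • v - (σ * φ ^ s * w ^ (-σ - 1)) • z, z⟫ * u ^ (m - 1)
        * ‖z‖ ^ (p - 2) * g
      ≤ φ ^ s * w ^ (-σ) * (Y * ‖z‖ - σ * ‖z‖ ^ 2 / w) * u ^ (m - 1) * ‖z‖ ^ (p - 2) * g := by
        gcongr
    _ = φ ^ s * w ^ (-σ) * ((Y * ‖z‖ - σ * ‖z‖ ^ 2 / w) * ‖z‖ ^ (p - 2)) * u ^ (m - 1) * g := by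
        ring
    _ ≤ φ ^ s * w ^ (-σ) * (Y ^ p * w ^ (p - 1) * σ ^ (-(p - 1))) * u ^ (m - 1) * g := by
        gcongr
    _ ≤ φ ^ s * w ^ (-σ) * (Y ^ p * w ^ (p - 1) * σ ^ (-(p - 1))) * w ^ (m - 1) * K := by
        gcongr
    _ = _ := by
        rw [show p + m - 2 = (p - 1) + (m - 1) by ring, Real.rpow_add hw]
        linear_combination K * w ^ (-σ) * w ^ (p - 1) * σ ^ (-(p - 1)) * w ^ (m - 1) * hYp

/-- Bounds for the primitive of `t ↦ t ^ (-σ)` started at `δ`. -/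
lemma rpow_primitive_bounds {σ δ w : ℝ} (hσ : σ ≤ 1 / 2) (hδ : 0 < δ) (hw : δ ≤ w) :
    0 ≤ (w ^ (1 - σ) - δ ^ (1 - σ)) / (1 - σ) ∧
      (w ^ (1 - σ) - δ ^ (1 - σ)) / (1 - σ) ≤ 2 * w * w ^ (-σ) := by
  have hw0 : 0 < w := hδ.trans_le hw
  have h1 : 0 < 1 - σ := by linarith
  constructor
  · exact div_nonneg (sub_nonneg.2 (Real.rpow_le_rpow hδ.le hw h1.le)) h1.le
  · have e : w * w ^ (-σ) = w ^ (1 - σ) := by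
      rw [sub_eq_add_neg, Real.rpow_add hw0, Real.rpow_one]
    have hd : 0 < δ ^ (1 - σ) := by positivity
    have hwp : 0 < w ^ (1 - σ) := by positivity
    rw [div_le_iff₀ h1, mul_assoc 2, e]
    nlinarith

/-- A locally Lipschitz function with compact support on a proper metric space is Lipschitz. -/
lemma LocallyLipschitz.exists_lipschitzWith_of_hasCompactSupport {E : Type*}
    [NormedAddCommGroup E] [ProperSpace E] {f : E → ℝ} (hf : LocallyLipschitz f)
    (hc : HasCompactSupport f) : ∃ L, LipschitzWith L f := by
  obtain ⟨r, hr⟩ := hc.isCompact.isBounded.subset_closedBall (0 : E)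
  obtain ⟨L, hL⟩ := (hf.locallyLipschitzOn (s := closedBall (0 : E) (r + 1))
    ).exists_lipschitzOnWith_of_compact (isCompact_closedBall _ _)
  obtain ⟨B, hB⟩ := hc.exists_bound_of_continuous hf.continuous
  have hB0 : 0 ≤ B := (norm_nonneg _).trans (hB 0)
  have hfar : ∀ x y : E, x ∈ tsupport f → y ∉ closedBall (0 : E) (r + 1) →
      dist (f x) (f y) ≤ B * dist x y := by
    intro x y hx hy
    have hy0 : f y = 0 := image_eq_zero_of_notMem_tsupport
      fun h => hy (closedBall_subset_closedBall (by linarith) (hr h))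
    have hx' := mem_closedBall_zero_iff.1 (hr hx)
    have hy' : r + 1 < ‖y‖ := by simpa using hy
    have hd : 1 ≤ dist x y := by
      rw [dist_comm, dist_eq_norm]
      linarith [norm_sub_norm_le y x]
    rw [hy0, dist_zero_right]
    nlinarith [hB x]
  refine ⟨L + B.toNNReal, LipschitzWith.of_dist_le_mul fun x y => ?_⟩
  have hL0 : 0 ≤ (L : ℝ) := L.2
  have hd0 : 0 ≤ dist x y := dist_nonneg
  have hcoe : ((L + B.toNNReal : NNReal) : ℝ) = L + B := by simp [hB0]
  rw [hcoe]
  by_cases hx : x ∈ closedBall (0 : E) (r + 1)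
  · by_cases hy : y ∈ closedBall (0 : E) (r + 1)
    · have := hL.dist_le_mul x hx y hy
      nlinarith
    · by_cases hxs : x ∈ tsupport f
      · have := hfar x y hxs hy
        nlinarith
      · rw [image_eq_zero_of_notMem_tsupport hxs, image_eq_zero_of_notMem_tsupport
          fun h => hy (closedBall_subset_closedBall (by linarith) (hr h)), dist_self]
        positivity
  · by_cases hys : y ∈ tsupport f
    · have := hfar y x hys hx
      rw [dist_comm, dist_comm y x] at this
      nlinarith
    · rw [image_eq_zero_of_notMem_tsupport hys, image_eq_zero_of_notMem_tsupport
          fun h => hx (closedBall_subset_closedBall (by linarith) (hr h)), dist_self]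
      positivity

/-- Rademacher's theorem for functions that are locally Lipschitz on an open set. -/
lemma LocallyLipschitzOn.ae_differentiableAt_of_isOpen {E : Type*} [NormedAddCommGroup E]
    [NormedSpace ℝ E] [FiniteDimensional ℝ E] [MeasurableSpace E] [BorelSpace E]
    {μ : Measure E} [μ.IsAddHaarMeasure] {f : E → ℝ} {U : Set E}
    (hf : LocallyLipschitzOn U f) (hU : IsOpen U) :
    ∀ᵐ z ∂μ.restrict U, DifferentiableAt ℝ f z := by
  rw [ae_restrict_iff' hU.measurableSet, ae_iff]
  refine measure_null_of_locally_null _ fun z hz => ?_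
  have hzU : z ∈ U := by
    by_contra h
    exact hz fun h' => absurd h' h
  obtain ⟨L, t, ht, hL⟩ := hf hzU
  rw [hU.nhdsWithin_eq hzU] at ht
  refine ⟨_, inter_mem_nhdsWithin _ (interior_mem_nhds.2 ht), ?_⟩
  have hL' := (hL.mono interior_subset).ae_differentiableWithinAt_of_mem (μ := μ)
  rw [ae_iff] at hL'
  refine measure_mono_null (fun y hy => ?_) hL'
  simp only [mem_ofPred_eq, Classical.not_imp] at hy ⊢
  exact ⟨hy.2, fun h => hy.1.2 (h.differentiableAt (isOpen_interior.mem_nhds hy.2))⟩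

/-- Composition of a pair of Lipschitz-near-`z` functions with a function that is `C¹` at the
image point. -/
lemma exists_lipschitzOnWith_comp₂ {X : Type*} [PseudoEMetricSpace X] {f g : X → ℝ} {z : X}
    {F : ℝ × ℝ → ℝ} (hf : ∃ L, ∃ t ∈ nhds z, LipschitzOnWith L f t)
    (hg : ∃ L, ∃ t ∈ nhds z, LipschitzOnWith L g t) (hF : ContDiffAt ℝ 1 F (f z, g z)) :
    ∃ L, ∃ t ∈ nhds z, LipschitzOnWith L (fun y => F (f y, g y)) t := by
  obtain ⟨L₁, t₁, ht₁, h₁⟩ := hf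
  obtain ⟨L₂, t₂, ht₂, h₂⟩ := hg
  obtain ⟨L, t, ht, h⟩ := hF.exists_lipschitzOnWith
  have hpair : LipschitzOnWith (max L₁ L₂) (fun y => (f y, g y)) (t₁ ∩ t₂) :=
    (h₁.mono inter_subset_left).prodMk (h₂.mono inter_subset_right)
  have hmem : t₁ ∩ t₂ ∈ nhds z := Filter.inter_mem ht₁ ht₂
  have hcont : ContinuousAt (fun y => (f y, g y)) z :=
    (hpair.continuousOn z (mem_of_mem_nhds hmem)).continuousAt hmem
  refine ⟨L * max L₁ L₂, (t₁ ∩ t₂) ∩ (fun y => (f y, g y)) ⁻¹' t,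
    Filter.inter_mem hmem (hcont ht), ?_⟩
  exact h.comp (hpair.mono inter_subset_left) (fun y hy => hy.2)

instance Euc.volume_prod_isAddHaarMeasure (N : ℕ) :
    (volume : Measure (Euc N × ℝ)).IsAddHaarMeasure :=
  inferInstanceAs ((volume : Measure (Euc N)).prod (volume : Measure ℝ)).IsAddHaarMeasure

lemma isOpen_Sset (N : ℕ) : IsOpen (Sset N) := isOpen_lt continuous_const continuous_snd

/-- The measure `dμ_a dt` has density `a` with respect to Lebesgue measure on the slab. -/
lemma muS_eq_withDensity {N : ℕ} {a : Euc N → ℝ} (ha : Measurable a) :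
    muS a = ((volume : Measure (Euc N × ℝ)).restrict (Sset N)).withDensity
      (fun z => ENNReal.ofReal (a z.1)) := by
  have hS : Sset N = univ ×ˢ Ioi (0 : ℝ) := by ext z; simp [Sset]
  rw [muS, muA, prod_withDensity_left ha.ennreal_ofReal, hS, Measure.volume_eq_prod,
    ← Measure.prod_restrict, Measure.restrict_univ]

lemma muS_absolutelyContinuous {N : ℕ} {a : Euc N → ℝ} (ha : Measurable a) :
    muS a ≪ (volume : Measure (Euc N × ℝ)).restrict (Sset N) := by
  rw [muS_eq_withDensity ha]; exact withDensity_absolutelyContinuous _ _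

/-- A time derivative of a compactly supported locally Lipschitz function integrates to zero. -/
lemma integral_fderiv_time_eq_zero {N : ℕ} {a : Euc N → ℝ} (haLip : LocallyLipschitz a)
    (ha0 : ∀ x, 0 ≤ a x) {ξ : Euc N × ℝ → ℝ} (hξ : LocallyLipschitz ξ)
    (hc : HasCompactSupport ξ) (hsub : tsupport ξ ⊆ Sset N) :
    Integrable (fun z => fderiv ℝ ξ z (0, 1)) (muS a) ∧
      ∫ z, fderiv ℝ ξ z (0, 1) ∂muS a = 0 := by
  set ζ : Euc N × ℝ → ℝ := fun z => a z.1 * ξ z with hζ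
  set v : Euc N × ℝ := (0, 1)
  have hζc : HasCompactSupport ζ := hc.mul_left
  have hζsub : tsupport ζ ⊆ tsupport ξ := closure_mono (by simp [hζ])
  have hloc : LocallyLipschitz ζ := fun z => by
    have h1 : LocallyLipschitz fun z : Euc N × ℝ => a z.1 :=
      haLip.comp LipschitzWith.prod_fst.locallyLipschitz
    exact exists_lipschitzOnWith_comp₂ (F := fun y => y.1 * y.2) (h1 z) (hξ z)
      (contDiff_fst.mul contDiff_snd).contDiffAt
  obtain ⟨L, hL⟩ := hloc.exists_lipschitzWith_of_hasCompactSupport hζc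
  have hzero : ∀ z, z ∉ tsupport ζ → lineDeriv ℝ ζ z v = 0 := by
    intro z hz
    have : ζ =ᶠ[nhds z] fun _ => 0 := notMem_tsupport_iff_eventuallyEq.1 hz
    rw [this.lineDeriv_eq]
    simp [lineDeriv]
  have hint : Integrable (fun z => lineDeriv ℝ ζ z v) := by
    rw [← integrableOn_iff_integrable_of_support_subset (s := tsupport ζ)
      (fun z hz => by by_contra h; exact hz (hzero z h))]
    exact (hL.locallyIntegrable_lineDeriv v).integrableOn_isCompact hζc.isCompact
  have hint0 : ∫ z, lineDeriv ℝ ζ z v = 0 := by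
    have h1 := LipschitzWith.integral_lineDeriv_mul_eq (μ := (volume : Measure (Euc N × ℝ)))
      (f := fun _ => (1 : ℝ)) (LipschitzWith.const (1 : ℝ)) hL hζc (-v)
    have h2 : ∀ z : Euc N × ℝ, lineDeriv ℝ (fun _ => (1 : ℝ)) z (-v) = 0 := fun z => by
      simp [lineDeriv]
    simpa [h2] using h1.symm
  have hae : ∀ᵐ z ∂(volume : Measure (Euc N × ℝ)),
      (ENNReal.ofReal (a z.1)).toReal • fderiv ℝ ξ z v = lineDeriv ℝ ζ z v := by
    obtain ⟨L', hL'⟩ := hξ.exists_lipschitzWith_of_hasCompactSupport hc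
    filter_upwards [hL'.ae_differentiableAt] with z hz
    have h1 := hz.hasFDerivAt.hasLineDerivAt v
    have h2 : HasLineDerivAt ℝ ζ (a z.1 * fderiv ℝ ξ z v) z v := by
      have := h1.const_mul (a z.1)
      unfold HasLineDerivAt
      simpa [hζ, v] using this
    rw [h2.lineDeriv, ENNReal.toReal_ofReal (ha0 _), smul_eq_mul]
  have hmeas : Measurable fun z : Euc N × ℝ => ENNReal.ofReal (a z.1) :=
    (haLip.continuous.measurable.comp measurable_fst).ennreal_ofReal
  have hfin : ∀ᵐ z ∂(volume : Measure (Euc N × ℝ)).restrict (Sset N),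
      ENNReal.ofReal (a z.1) < ⊤ := Filter.Eventually.of_forall fun z => ENNReal.ofReal_lt_top
  have hae' := ae_restrict_of_ae (s := Sset N) hae
  rw [muS_eq_withDensity haLip.continuous.measurable]
  constructor
  · rw [integrable_withDensity_iff_integrable_smul' hmeas hfin]
    exact hint.restrict.congr (by filter_upwards [hae'] with z hz using hz.symm)
  · rw [integral_withDensity_eq_integral_toReal_smul hmeas hfin, integral_congr_ae hae',
      setIntegral_eq_integral_of_forall_compl_eq_zero, hint0]
    exact fun z hz => hzero z fun h => hz (hsub (hζsub h))

/-- Adding an integrable function of zero mean does not change a (possibly divergent) Bochner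
integral. -/
lemma integral_add_of_integral_eq_zero {X : Type*} [MeasurableSpace X] {μ : Measure X}
    {f g : X → ℝ} (hg : Integrable g μ) (hg0 : ∫ x, g x ∂μ = 0) :
    ∫ x, (f x + g x) ∂μ = ∫ x, f x ∂μ := by
  by_cases hf : Integrable f μ
  · rw [integral_add hf hg, hg0, add_zero]
  · rw [integral_undef hf, integral_undef]
    intro h
    exact hf ((h.sub hg).congr (Filter.Eventually.of_forall fun x => by simp))

lemma ofReal_integral_le_lintegral_ofReal {X : Type*} [MeasurableSpace X] {μ : Measure X}
    (f : X → ℝ) : ENNReal.ofReal (∫ x, f x ∂μ) ≤ ∫⁻ x, ENNReal.ofReal (f x) ∂μ := by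
  by_cases hf : Integrable f μ
  · have hpos : Integrable (fun x => max (f x) 0) μ := hf.pos_part
    calc ENNReal.ofReal (∫ x, f x ∂μ) ≤ ENNReal.ofReal (∫ x, max (f x) 0 ∂μ) :=
          ENNReal.ofReal_le_ofReal (integral_mono hf hpos fun x => le_max_left _ _)
      _ = ∫⁻ x, ENNReal.ofReal (max (f x) 0) ∂μ :=
          ofReal_integral_eq_lintegral_ofReal hpos
            (Filter.Eventually.of_forall fun x => le_max_right _ _)
      _ = _ := by simp
  · simp [integral_undef hf]

/-- Logarithmic parabolic radius, truncated from below at scale `R`. -/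
def logRadius {N : ℕ} (R γ : ℝ) (z : Euc N × ℝ) : ℝ :=
  max (Real.log (max ‖z.1‖ R)) (γ⁻¹ * Real.log (max z.2 (R ^ γ)))

/-- Cutoff equal to `1` at parabolic scales below `R`, vanishing beyond scale `R ^ 2` and for
`t ≤ 1 / R`, and interpolating linearly in the logarithm of the parabolic radius. -/
def logCutoff {N : ℕ} (R γ : ℝ) (z : Euc N × ℝ) : ℝ :=
  max 0 (min (2 - logRadius R γ z / Real.log R) (R * z.2 - 1))

lemma abs_log_max_sub_log_max_le {a b c : ℝ} (hc : 0 < c) :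
    |Real.log (max a c) - Real.log (max b c)| ≤ c⁻¹ * |a - b| := by
  wlog hab : a ≤ b generalizing a b
  · rw [abs_sub_comm, abs_sub_comm a]; exact this (le_of_not_ge hab)
  have ha : 0 < max a c := lt_max_of_lt_right hc
  have hb : 0 < max b c := lt_max_of_lt_right hc
  have hle : max a c ≤ max b c := max_le_max_right _ hab
  rw [abs_sub_comm, abs_of_nonneg (sub_nonneg.2 (Real.log_le_log ha hle)), abs_sub_comm a,
    abs_of_nonneg (sub_nonneg.2 hab), ← Real.log_div hb.ne' ha.ne']
  have h1 := Real.log_le_sub_one_of_pos (div_pos hb ha)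
  have h2 : max b c - max a c ≤ b - a := by
    have := abs_max_sub_max_le_abs b a c
    rw [abs_of_nonneg (sub_nonneg.2 hab)] at this
    exact (le_abs_self _).trans this
  calc Real.log (max b c / max a c) ≤ (max b c - max a c) / max a c := by
        rw [sub_div, div_self ha.ne']; exact h1
    _ ≤ (b - a) / c := by
        have h3 : 0 ≤ b - a := sub_nonneg.2 hab
        gcongr
        exact le_max_right _ _
    _ = _ := by rw [div_eq_inv_mul]

lemma log_max_sub_log_max_le {a b c : ℝ} (ha : 0 < a) (hab : a ≤ b) :
    Real.log (max b c) - Real.log (max a c) ≤ (b - a) / a := by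
  have hA : 0 < max a c := lt_max_of_lt_left ha
  have h := (le_abs_self _).trans (abs_log_max_sub_log_max_le (a := b) (b := max a c) hA)
  have h1 : max b (max a c) = max b c := by
    rw [← max_assoc, max_eq_left hab]
  rw [h1, max_self] at h
  rcases le_total b (max a c) with hb | hb
  · have : Real.log (max b c) ≤ Real.log (max a c) :=
      Real.log_le_log (lt_max_of_lt_left (ha.trans_le hab)) (max_le hb (le_max_right _ _))
    have h3 : 0 ≤ (b - a) / a := div_nonneg (sub_nonneg.2 hab) ha.le
    linarith
  · rw [abs_of_nonneg (sub_nonneg.2 hb), inv_mul_eq_div] at h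
    refine h.trans ?_
    have : 0 ≤ b - a := sub_nonneg.2 hab
    gcongr
    · exact le_max_left _ _
    · exact le_max_left _ _

lemma locallyLipschitz_log_max {c : ℝ} (hc : 0 < c) :
    LocallyLipschitz fun s : ℝ => Real.log (max s c) := by
  refine (LipschitzWith.of_dist_le_mul (K := (c⁻¹).toNNReal) fun a b => ?_).locallyLipschitz
  rw [Real.dist_eq, Real.dist_eq, Real.coe_toNNReal _ (by positivity)]
  exact abs_log_max_sub_log_max_le hc

lemma locallyLipschitz_logRadius {N : ℕ} {R γ : ℝ} (hR : 1 < R) :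
    LocallyLipschitz (logRadius (N := N) R γ) := by
  have hR0 : 0 < R := by linarith
  refine LocallyLipschitz.max ?_ ?_
  · exact (locallyLipschitz_log_max hR0).comp
      (lipschitzWith_one_norm.locallyLipschitz.comp LipschitzWith.prod_fst.locallyLipschitz)
  · have h1 : LocallyLipschitz fun s : ℝ => γ⁻¹ * s := by
      simpa using (lipschitzWith_smul (γ⁻¹ : ℝ) (β := ℝ)).locallyLipschitz
    exact h1.comp ((locallyLipschitz_log_max (c := R ^ γ) (by positivity)).comp
      LipschitzWith.prod_snd.locallyLipschitz)

lemma locallyLipschitz_logCutoff {N : ℕ} {R γ : ℝ} (hR : 1 < R) :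
    LocallyLipschitz (logCutoff (N := N) R γ) := by
  have h1 : LocallyLipschitz fun s : ℝ => 2 - s / Real.log R :=
    ContDiff.locallyLipschitz (𝕂 := ℝ) (by fun_prop)
  have h2 : LocallyLipschitz fun s : ℝ => R * s - 1 :=
    ContDiff.locallyLipschitz (𝕂 := ℝ) (by fun_prop)
  exact (LocallyLipschitz.const 0).max
    ((h1.comp (locallyLipschitz_logRadius hR)).min
      (h2.comp LipschitzWith.prod_snd.locallyLipschitz))

lemma logCutoff_nonneg {N : ℕ} {R γ : ℝ} (z : Euc N × ℝ) : 0 ≤ logCutoff R γ z := le_max_left _ _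

lemma log_le_logRadius {N : ℕ} {R γ : ℝ} (hR : 1 < R) (z : Euc N × ℝ) :
    Real.log R ≤ logRadius R γ z :=
  le_max_of_le_left (Real.log_le_log (by linarith) (le_max_right _ _))

lemma logCutoff_le_one {N : ℕ} {R γ : ℝ} (hR : 1 < R) (z : Euc N × ℝ) : logCutoff R γ z ≤ 1 := by
  refine max_le zero_le_one ((min_le_left _ _).trans ?_)
  have : 1 ≤ logRadius R γ z / Real.log R := by
    rw [one_le_div (Real.log_pos hR)]; exact log_le_logRadius hR z
  linarith

lemma logCutoff_eq_zero_of_time_le {N : ℕ} {R γ : ℝ} (hR : 1 < R) {z : Euc N × ℝ}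
    (hz : z.2 ≤ R⁻¹) : logCutoff R γ z = 0 := by
  refine max_eq_left ((min_le_right _ _).trans ?_)
  have hR0 : 0 < R := by linarith
  have : R * z.2 ≤ R * R⁻¹ := by gcongr
  rw [mul_inv_cancel₀ hR0.ne'] at this
  linarith

lemma logCutoff_eq_zero_of_two_mul_log_le {N : ℕ} {R γ : ℝ} (hR : 1 < R) {z : Euc N × ℝ}
    (hz : 2 * Real.log R ≤ logRadius R γ z) : logCutoff R γ z = 0 := by
  refine max_eq_left ((min_le_left _ _).trans ?_)
  have : 2 ≤ logRadius R γ z / Real.log R := by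
    rw [le_div_iff₀ (Real.log_pos hR)]; exact hz
  linarith

lemma logCutoff_eq_zero_of_le_norm {N : ℕ} {R γ : ℝ} (hR : 1 < R) {z : Euc N × ℝ}
    (hz : R ^ 2 ≤ ‖z.1‖) : logCutoff R γ z = 0 := by
  refine logCutoff_eq_zero_of_two_mul_log_le hR (le_max_of_le_left ?_)
  have h := Real.log_le_log (by positivity) (hz.trans (le_max_left _ R))
  rwa [Real.log_pow] at h

lemma logCutoff_eq_zero_of_le_time {N : ℕ} {R γ : ℝ} (hR : 1 < R) (hγ : 0 < γ) {z : Euc N × ℝ}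
    (hz : R ^ (2 * γ) ≤ z.2) : logCutoff R γ z = 0 := by
  have hR0 : 0 < R := by linarith
  refine logCutoff_eq_zero_of_two_mul_log_le hR (le_max_of_le_right ?_)
  have h := Real.log_le_log (by positivity) (hz.trans (le_max_left _ (R ^ γ)))
  rw [Real.log_rpow hR0] at h
  rw [inv_mul_eq_div, le_div_iff₀ hγ]
  linarith

lemma logCutoff_eq_one {N : ℕ} {R γ : ℝ} (hR : 1 < R) (hγ : 0 < γ) {z : Euc N × ℝ}
    (hx : ‖z.1‖ ≤ R) (ht : z.2 ≤ R ^ γ) (ht' : 2 ≤ R * z.2) : logCutoff R γ z = 1 := by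
  have hR0 : 0 < R := by linarith
  have h : logRadius R γ z = Real.log R := by
    rw [logRadius, max_eq_right hx, max_eq_right ht, Real.log_rpow hR0,
      inv_mul_cancel_left₀ hγ.ne', max_self]
  rw [logCutoff, h, div_self (Real.log_pos hR).ne', min_eq_left (by linarith)]
  norm_num

lemma logCutoff_support_subset {N : ℕ} {R γ : ℝ} (hR : 1 < R) (hγ : 0 < γ) :
    tsupport (logCutoff (N := N) R γ) ⊆ closedBall 0 (R ^ 2) ×ˢ Icc R⁻¹ (R ^ (2 * γ)) := by
  refine closure_minimal (fun z hz => ?_) (isClosed_closedBall.prod isClosed_Icc)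
  refine ⟨?_, ?_, ?_⟩
  · by_contra h
    exact hz (logCutoff_eq_zero_of_le_norm hR (by simpa using (not_le.1 (by simpa using h)).le))
  · by_contra h
    exact hz (logCutoff_eq_zero_of_time_le hR (le_of_not_ge h))
  · by_contra h
    exact hz (logCutoff_eq_zero_of_le_time hR hγ (le_of_not_ge h))

lemma logCutoff_sub_le {N : ℕ} {R γ k : ℝ} (hR : 1 < R) {z y : Euc N × ℝ} (hk : 0 ≤ k)
    (ht : z.2 ≤ y.2) (h : logRadius R γ y ≤ logRadius R γ z + k) :
    logCutoff R γ z - k / Real.log R ≤ logCutoff R γ y := by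
  have hl := Real.log_pos hR
  have hR0 : 0 < R := by linarith
  have h0 : 0 ≤ k / Real.log R := by positivity
  have h1 : logRadius R γ y / Real.log R ≤ logRadius R γ z / Real.log R + k / Real.log R := by
    rw [← add_div]; gcongr
  have h2 : R * z.2 ≤ R * y.2 := by gcongr
  unfold logCutoff
  rw [sub_le_iff_le_add]
  refine max_le (add_nonneg (le_max_left _ _) h0) ?_
  rw [← sub_le_iff_le_add]
  refine le_max_of_le_right (le_min ?_ ?_)
  · linarith [min_le_left (2 - logRadius R γ z / Real.log R) (R * z.2 - 1)]
  · linarith [min_le_right (2 - logRadius R γ z / Real.log R) (R * z.2 - 1)]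

lemma neg_le_of_hasDerivAt_of_right {g : ℝ → ℝ} {d k t₀ : ℝ} (hg : HasDerivAt g d t₀)
    (h : ∀ᶠ t in nhdsWithin t₀ (Ioi t₀), g t₀ - k * (t - t₀) ≤ g t) : -k ≤ d := by
  have h1 := hg.tendsto_slope.mono_left
    (nhdsWithin_mono t₀ (fun t (ht : t₀ < t) => ht.ne') : nhdsWithin t₀ (Ioi t₀) ≤ _)
  refine ge_of_tendsto h1 ?_
  filter_upwards [h, self_mem_nhdsWithin] with t ht (ht' : t₀ < t)
  rw [slope_def_field, le_div_iff₀ (sub_pos.2 ht')]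
  linarith

lemma HasFDerivAt.hasFDerivAt_space_slice {N : ℕ} {φ : Euc N × ℝ → ℝ} {v : Euc N} {c : ℝ}
    {z : Euc N × ℝ} (h : HasFDerivAt φ (pairCLM v c) z) :
    HasFDerivAt (fun x => φ (x, z.2)) (innerSL ℝ v) z.1 := by
  have h1 : HasFDerivAt (fun x : Euc N => (x, z.2)) (ContinuousLinearMap.inl ℝ (Euc N) ℝ) z.1 :=
    hasFDerivAt_prodMk_left z.1 z.2
  have h2 := HasFDerivAt.comp (g := φ) z.1 h h1
  convert! h2 using 1
  ext w
  simp [pairCLM]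

lemma HasFDerivAt.hasDerivAt_time_slice {N : ℕ} {φ : Euc N × ℝ → ℝ} {v : Euc N} {c : ℝ}
    {z : Euc N × ℝ} (h : HasFDerivAt φ (pairCLM v c) z) :
    HasDerivAt (fun t => φ (z.1, t)) c z.2 := by
  have h1 : HasFDerivAt (fun t : ℝ => (z.1, t)) (ContinuousLinearMap.inr ℝ (Euc N) ℝ) z.2 :=
    hasFDerivAt_prodMk_right z.1 z.2
  have h2 := (HasFDerivAt.comp (g := φ) z.2 h h1).hasDerivAt
  convert! h2 using 1
  simp [pairCLM]

lemma abs_logCutoff_sub_le {N : ℕ} {R γ : ℝ} (hR : 1 < R) (x y : Euc N) (t : ℝ) :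
    |logCutoff R γ (x, t) - logCutoff R γ (y, t)|
      ≤ |Real.log (max ‖x‖ R) - Real.log (max ‖y‖ R)| / Real.log R := by
  set k := |Real.log (max ‖x‖ R) - Real.log (max ‖y‖ R)| with hk
  have hk0 : 0 ≤ k := abs_nonneg _
  have key : ∀ x y : Euc N, Real.log (max ‖x‖ R) ≤ Real.log (max ‖y‖ R) + k →
      logRadius R γ (x, t) ≤ logRadius R γ (y, t) + k := by
    intro x y h
    refine max_le (h.trans ?_) ?_
    · gcongr; exact le_max_left _ _
    · exact (le_max_right _ _).trans (le_add_of_nonneg_right hk0)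
  have h1 := logCutoff_sub_le (z := (y, t)) (y := (x, t)) hR hk0 le_rfl
    (key x y (by linarith [le_abs_self (Real.log (max ‖x‖ R) - Real.log (max ‖y‖ R))]))
  have h2 := logCutoff_sub_le (z := (x, t)) (y := (y, t)) hR hk0 le_rfl
    (key y x (by linarith [neg_abs_le (Real.log (max ‖x‖ R) - Real.log (max ‖y‖ R))]))
  rw [abs_le]
  constructor <;> linarith

lemma log_max_le_inv_mul_log_max {r t R γ : ℝ} (hR : 1 < R) (hγ : 0 < γ)
    (h : r ^ γ ≤ t) : Real.log (max r R) ≤ γ⁻¹ * Real.log (max t (R ^ γ)) := by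
  have hR0 : 0 < R := by linarith
  have hm : 0 < max r R := lt_max_of_lt_right hR0
  rw [inv_mul_eq_div, le_div_iff₀ hγ, mul_comm, ← Real.log_rpow hm]
  refine Real.log_le_log (by positivity) ?_
  rcases le_total r R with h1 | h1
  · rw [max_eq_right h1]; exact le_max_right _ _
  · rw [max_eq_left h1]; exact le_max_of_le_left h

/-- Size and location of the spatial gradient of the logarithmic cutoff. -/
lemma logCutoff_space_deriv {N : ℕ} {R γ : ℝ} (hR : 1 < R) (hγ : 0 < γ) {z : Euc N × ℝ}
    {v : Euc N} {c : ℝ} (h : HasFDerivAt (logCutoff R γ) (pairCLM v c) z) (hv : v ≠ 0) :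
    R ≤ ‖z.1‖ ∧ ‖z.1‖ ≤ R ^ 2 ∧ z.2 ≤ ‖z.1‖ ^ γ ∧ ‖v‖ ≤ 2 / (‖z.1‖ * Real.log R) := by
  have hs := h.hasFDerivAt_space_slice
  have hR0 : 0 < R := by linarith
  have hl := Real.log_pos hR
  have hconst : ∀ C : ℝ, (∀ᶠ x in nhds z.1, logCutoff R γ (x, z.2) = C) → False := by
    intro C hC
    have h0 : HasFDerivAt (fun x => logCutoff R γ (x, z.2)) (0 : Euc N →L[ℝ] ℝ) z.1 :=
      (hasFDerivAt_const C z.1).congr_of_eventuallyEq hC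
    have := hs.unique h0
    apply hv
    rw [← norm_eq_zero, ← innerSL_apply_norm (𝕜 := ℝ), this, norm_zero]
  have h1 : R ≤ ‖z.1‖ := by
    by_contra hlt
    push Not at hlt
    refine hconst (logCutoff R γ z) ?_
    filter_upwards [continuous_norm.continuousAt.eventually_lt continuousAt_const hlt] with x hx
    simp only [logCutoff, logRadius, max_eq_right hx.le, max_eq_right hlt.le]
  refine ⟨h1, ?_, ?_, ?_⟩
  · by_contra hlt
    push Not at hlt
    refine hconst 0 ?_
    filter_upwards [continuousAt_const.eventually_lt continuous_norm.continuousAt hlt] with x hx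
    exact logCutoff_eq_zero_of_le_norm hR hx.le
  · by_contra hlt
    push Not at hlt
    refine hconst (logCutoff R γ z) ?_
    have hc : Continuous fun x : Euc N => ‖x‖ ^ γ :=
      continuous_norm.rpow_const fun x => Or.inr hγ.le
    filter_upwards [hc.continuousAt.eventually_lt continuousAt_const hlt] with x hx
    simp only [logCutoff, logRadius,
      max_eq_right (log_max_le_inv_mul_log_max hR hγ hx.le),
      max_eq_right (log_max_le_inv_mul_log_max hR hγ hlt.le)]
  · have hz0 : 0 < ‖z.1‖ := hR0.trans_le h1
    rw [← innerSL_apply_norm (𝕜 := ℝ)]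
    refine hs.le_of_lip' (by positivity) ?_
    have hhalf : ‖z.1‖ / 2 < ‖z.1‖ := by linarith
    filter_upwards [continuousAt_const.eventually_lt continuous_norm.continuousAt hhalf] with x hx
    rw [Real.norm_eq_abs]
    refine (abs_logCutoff_sub_le hR _ _ _).trans ?_
    have h3 := abs_log_max_sub_log_max_le (a := max ‖x‖ R) (b := max ‖z.1‖ R)
      (c := ‖z.1‖ / 2) (by positivity)
    rw [max_eq_left (le_max_of_le_left hx.le), max_eq_left (le_max_of_le_left hhalf.le)] at h3
    have h4 : |max ‖x‖ R - max ‖z.1‖ R| ≤ ‖x - z.1‖ :=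
      (abs_max_sub_max_le_abs _ _ _).trans (abs_norm_sub_norm_le _ _)
    calc |Real.log (max ‖x‖ R) - Real.log (max ‖z.1‖ R)| / Real.log R
        ≤ ((‖z.1‖ / 2)⁻¹ * ‖x - z.1‖) / Real.log R := by
          gcongr
          exact h3.trans (by gcongr)
      _ = _ := by field_simp

/-- Size and location of the negative part of the time derivative of the logarithmic cutoff. -/
lemma logCutoff_time_deriv {N : ℕ} {R γ : ℝ} (hR : 1 < R) (hγ : 0 < γ) {z : Euc N × ℝ}
    {v : Euc N} {c : ℝ} (h : HasFDerivAt (logCutoff R γ) (pairCLM v c) z) (hz : 0 < z.2)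
    (hc : c < 0) :
    R ^ γ ≤ z.2 ∧ z.2 ≤ R ^ (2 * γ) ∧ ‖z.1‖ ^ γ ≤ z.2 ∧ -c ≤ 1 / (γ * z.2 * Real.log R) := by
  have hs := h.hasDerivAt_time_slice
  have hR0 : 0 < R := by linarith
  have hl := Real.log_pos hR
  have hmono : (∀ᶠ t in nhdsWithin z.2 (Ioi z.2),
      logCutoff R γ z ≤ logCutoff R γ (z.1, t)) → False := by
    intro hm
    have := neg_le_of_hasDerivAt_of_right (k := 0) hs (by simpa using hm)
    linarith
  have hrad : (∀ᶠ t in nhdsWithin z.2 (Ioi z.2),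
      logRadius R γ (z.1, t) ≤ logRadius R γ z) → False := by
    intro hm
    refine hmono ?_
    filter_upwards [hm, self_mem_nhdsWithin] with t ht (ht' : z.2 < t)
    have := logCutoff_sub_le (z := z) (y := (z.1, t)) (k := 0) hR le_rfl ht'.le (by simpa using ht)
    simpa using this
  refine ⟨?_, ?_, ?_, ?_⟩
  · by_contra hlt
    push Not at hlt
    refine hrad ?_
    filter_upwards [nhdsWithin_le_nhds (Iio_mem_nhds hlt)] with t (ht : t < R ^ γ)
    simp [logRadius, max_eq_right ht.le, max_eq_right hlt.le]
  · by_contra hlt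
    push Not at hlt
    refine hmono (Filter.Eventually.of_forall fun t => ?_)
    rw [logCutoff_eq_zero_of_le_time hR hγ hlt.le]
    exact logCutoff_nonneg _
  · by_contra hlt
    push Not at hlt
    refine hrad ?_
    filter_upwards [nhdsWithin_le_nhds (Iio_mem_nhds hlt), self_mem_nhdsWithin] with t
      (ht : t < ‖z.1‖ ^ γ) (ht' : z.2 < t)
    refine max_le (le_max_left _ _) (le_max_of_le_left ?_)
    have hm : 0 < max ‖z.1‖ R := lt_max_of_lt_right hR0
    rw [inv_mul_eq_div, div_le_iff₀ hγ, mul_comm, ← Real.log_rpow hm]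
    refine Real.log_le_log (by positivity) (max_le (ht.le.trans ?_) ?_)
    · exact Real.rpow_le_rpow (norm_nonneg _) (le_max_left _ _) hγ.le
    · exact Real.rpow_le_rpow hR0.le (le_max_right _ _) hγ.le
  · have := neg_le_of_hasDerivAt_of_right (k := 1 / (γ * z.2 * Real.log R)) hs ?_
    · linarith
    · filter_upwards [self_mem_nhdsWithin] with t (ht : z.2 < t)
      have hd : 0 < t - z.2 := sub_pos.2 ht
      have := logCutoff_sub_le (z := z) (y := (z.1, t)) (γ := γ) (k := γ⁻¹ * ((t - z.2) / z.2))
        hR (by positivity) ht.le ?_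
      · refine le_trans (le_of_eq ?_) this
        congr 1
        field_simp
      · refine max_le ((le_max_left _ _).trans (le_add_of_nonneg_right (by positivity))) ?_
        have h5 := log_max_sub_log_max_le (c := R ^ γ) hz ht.le
        calc γ⁻¹ * Real.log (max t (R ^ γ))
            ≤ γ⁻¹ * (Real.log (max z.2 (R ^ γ)) + (t - z.2) / z.2) := by gcongr; linarith
          _ = γ⁻¹ * Real.log (max z.2 (R ^ γ)) + γ⁻¹ * ((t - z.2) / z.2) := mul_add _ _ _
          _ ≤ _ := by gcongr; exact le_max_right _ _

lemma pairCLM_apply {N : ℕ} (v : Euc N) (c : ℝ) (y : Euc N × ℝ) :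
    pairCLM v c y = ⟪v, y.1⟫ + c * y.2 := by simp [pairCLM]

/-- Spatial gradient of a function on space-time, read off from its Fréchet derivative. -/
def spaceGrad {N : ℕ} (φ : Euc N × ℝ → ℝ) (z : Euc N × ℝ) : Euc N :=
  (InnerProductSpace.toDual ℝ (Euc N)).symm
    ((fderiv ℝ φ z).comp (ContinuousLinearMap.inl ℝ (Euc N) ℝ))

/-- Time derivative of a function on space-time, read off from its Fréchet derivative. -/
def timeDeriv {N : ℕ} (φ : Euc N × ℝ → ℝ) (z : Euc N × ℝ) : ℝ := fderiv ℝ φ z (0, 1)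

lemma DifferentiableAt.hasFDerivAt_pairCLM {N : ℕ} {φ : Euc N × ℝ → ℝ} {z : Euc N × ℝ}
    (h : DifferentiableAt ℝ φ z) :
    HasFDerivAt φ (pairCLM (spaceGrad φ z) (timeDeriv φ z)) z := by
  convert! h.hasFDerivAt using 1
  refine ContinuousLinearMap.ext fun y => ?_
  rw [pairCLM_apply, spaceGrad, InnerProductSpace.toDual_symm_apply, timeDeriv, mul_comm,
    ← smul_eq_mul, ← map_smul]
  simp only [ContinuousLinearMap.coe_comp, Function.comp_apply, ContinuousLinearMap.inl_apply,
    Prod.smul_mk, smul_zero, smul_eq_mul, mul_one]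
  rw [← map_add]
  simp

/-- Functions of the form `F (logCutoff, u)` with `F` vanishing on `{0} × ℝ` are admissible test
functions. -/
lemma testFunction_regularity {N : ℕ} {u : Euc N × ℝ → ℝ} (hu0 : ∀ z ∈ Sset N, 0 ≤ u z)
    (huLip : LocallyLipschitzOn (Sset N) u) {R γ : ℝ} (hR : 1 < R) (hγ : 0 < γ)
    {F : ℝ × ℝ → ℝ} (hF0 : ∀ b, F (0, b) = 0) (hF : ∀ c b, 0 ≤ b → ContDiffAt ℝ 1 F (c, b)) :
    LocallyLipschitz (fun z => F (logCutoff R γ z, u z)) ∧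
      HasCompactSupport (fun z => F (logCutoff R γ z, u z)) ∧
      tsupport (fun z => F (logCutoff R γ z, u z)) ⊆ Sset N := by
  have hR0 : 0 < R := by linarith
  have hsub : tsupport (fun z => F (logCutoff R γ z, u z)) ⊆ tsupport (logCutoff (N := N) R γ) := by
    refine closure_mono fun z hz h => hz ?_
    simp only [h, hF0]
  have hsub' := hsub.trans (logCutoff_support_subset hR hγ)
  refine ⟨fun z => ?_, ?_, fun z hz => (inv_pos.2 hR0).trans_le (hsub' hz).2.1⟩
  · by_cases hz : z ∈ Sset N
    · refine exists_lipschitzOnWith_comp₂ (locallyLipschitz_logCutoff hR z) ?_ (hF _ _ (hu0 z hz))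
      have := huLip hz
      rwa [(isOpen_Sset N).nhdsWithin_eq hz] at this
    · have hz' : z.2 < R⁻¹ := (not_lt.1 hz).trans_lt (inv_pos.2 hR0)
      refine ⟨0, {y | y.2 < R⁻¹}, (isOpen_lt continuous_snd continuous_const).mem_nhds hz', ?_⟩
      intro y (hy : y.2 < R⁻¹) y' (hy' : y'.2 < R⁻¹)
      simp [logCutoff_eq_zero_of_time_le hR hy.le, logCutoff_eq_zero_of_time_le hR hy'.le, hF0]
  · exact ((isCompact_closedBall _ _).prod isCompact_Icc).of_isClosed_subset
      (isClosed_tsupport _) hsub'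

/-- The basic integral estimate, obtained by testing the inequality with
`logCutoff ^ s * (u + δ) ^ (-σ)`. -/
lemma IsWeakSol.lintegral_cutoff_le {N : ℕ} {p m q K : ℝ} {V : Euc N × ℝ → ℝ} {f : ℝ → ℝ}
    {a : Euc N → ℝ} {u : Euc N × ℝ → ℝ} {gu : Euc N × ℝ → Euc N} {ut : Euc N × ℝ → ℝ}
    (hu : IsWeakSol N p m q V f a u gu ut) (hp : 1 < p) (hm : 1 ≤ m)
    (hf : ∀ s : ℝ, 0 ≤ s → 0 ≤ f s ∧ f s ≤ K) (haLip : LocallyLipschitz a) (ha0 : ∀ x, 0 ≤ a x)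
    (hV : ∀ᵐ z ∂((volume : Measure (Euc N × ℝ)).restrict (Sset N)), 0 < V z)
    {R γ σ δ : ℝ} {s : ℕ} (hR : 1 < R) (hγ : 0 < γ) (hσ : 0 < σ) (hσ' : σ ≤ 1 / 2) (hδ : 0 < δ)
    (hs : 2 ≤ s) :
    ∫⁻ z, ENNReal.ofReal (logCutoff R γ z ^ s * (u z + δ) ^ (-σ) * u z ^ q * V z) ∂muS a ≤
      ∫⁻ z, ENNReal.ofReal (K * s ^ p * σ ^ (-(p - 1)) * ‖spaceGrad (logCutoff R γ) z‖ ^ p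
          * logCutoff R γ z ^ ((s : ℝ) - p) * (u z + δ) ^ (p + m - 2) * (u z + δ) ^ (-σ)) ∂muS a
      + ∫⁻ z, ENNReal.ofReal (s * logCutoff R γ z ^ (s - 1)
          * max 0 (-timeDeriv (logCutoff R γ) z) * (2 * (u z + δ) * (u z + δ) ^ (-σ))) ∂muS a := by
  have hR0 : 0 < R := by linarith
  have hσ1 : (0 : ℝ) < 1 - σ := by linarith
  have hac := muS_absolutelyContinuous haLip.continuous.measurable
  have hs0 : s ≠ 0 := by omega
  have hs1 : s - 1 ≠ 0 := by omega
  set φ : Euc N × ℝ → ℝ := logCutoff R γ with hφ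
  set ψ : Euc N × ℝ → ℝ := fun z => φ z ^ s * (u z + δ) ^ (-σ) with hψ
  set Ψ : ℝ → ℝ := fun b => ((b + δ) ^ (1 - σ) - δ ^ (1 - σ)) / (1 - σ) with hΨ
  set ξ : Euc N × ℝ → ℝ := fun z => φ z ^ s * (u z * (u z + δ) ^ (-σ) - Ψ (u z)) with hξ
  set gψ : Euc N × ℝ → Euc N := fun z =>
    (s * φ z ^ (s - 1) * (u z + δ) ^ (-σ)) • spaceGrad φ z
      - (σ * φ z ^ s * (u z + δ) ^ (-σ - 1)) • gu z with hgψ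
  set tψ : Euc N × ℝ → ℝ := fun z =>
    s * φ z ^ (s - 1) * (u z + δ) ^ (-σ) * timeDeriv φ z
      - σ * φ z ^ s * (u z + δ) ^ (-σ - 1) * ut z with htψ
  obtain ⟨hψLip, hψc, hψS⟩ := testFunction_regularity (F := fun y => y.1 ^ s * (y.2 + δ) ^ (-σ))
    hu.nonneg hu.locLip hR hγ (fun b => by simp [hs0]) (fun c b hb => by
      refine (contDiffAt_fst.pow s).mul ((contDiffAt_snd.add contDiffAt_const).rpow_const_of_ne ?_)
      simp only; positivity)
  obtain ⟨hξLip, hξc, hξS⟩ := testFunction_regularity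
    (F := fun y => y.1 ^ s * (y.2 * (y.2 + δ) ^ (-σ) - Ψ y.2))
    hu.nonneg hu.locLip hR hγ (fun b => by simp [hs0]) (fun c b hb => by
      have h0 : b + δ ≠ 0 := by positivity
      refine (contDiffAt_fst.pow s).mul ((contDiffAt_snd.mul
        ((contDiffAt_snd.add contDiffAt_const).rpow_const_of_ne h0)).sub ?_)
      exact ((((contDiffAt_snd.add contDiffAt_const).rpow_const_of_ne h0).sub
        contDiffAt_const).div_const _))
  have hφd : ∀ᵐ z ∂(volume : Measure (Euc N × ℝ)), DifferentiableAt ℝ φ z := by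
    have := ((locallyLipschitz_logCutoff (N := N) (γ := γ) hR).locallyLipschitzOn
      (s := univ)).ae_differentiableAt_of_isOpen (μ := (volume : Measure (Euc N × ℝ))) isOpen_univ
    rwa [Measure.restrict_univ] at this
  have hud : ∀ᵐ z ∂(volume : Measure (Euc N × ℝ)).restrict (Sset N),
      HasFDerivAt u (pairCLM (gu z) (ut z)) z := by
    filter_upwards [hu.deriv_ae, hu.locLip.ae_differentiableAt_of_isOpen (isOpen_Sset N)]
      with z h1 h2 using h1 h2
  have hψnn : ∀ z, 0 ≤ ψ z := by
    intro z
    by_cases hz : z ∈ Sset N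
    · have := hu.nonneg z hz
      have := logCutoff_nonneg (R := R) (γ := γ) z
      positivity
    · have : φ z = 0 :=
        logCutoff_eq_zero_of_time_le hR ((not_lt.1 hz).trans (inv_pos.2 hR0).le)
      simp [hψ, this, hs0]
  have hψd : ∀ᵐ z ∂(volume : Measure (Euc N × ℝ)),
      DifferentiableAt ℝ ψ z → HasFDerivAt ψ (pairCLM (gψ z) (tψ z)) z := by
    rw [ae_restrict_iff' (isOpen_Sset N).measurableSet] at hud
    filter_upwards [hφd, hud] with z h1 h2 _
    by_cases hz : z ∈ Sset N
    · have hw : u z + δ ≠ 0 := by linarith [hu.nonneg z hz]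
      have hpow := (hasDerivAt_pow s (φ z)).comp_hasFDerivAt z h1.hasFDerivAt_pairCLM
      have hrp := (((hasDerivAt_id (u z)).add_const δ).rpow_const (p := -σ)
        (Or.inl hw)).comp_hasFDerivAt z (h2 hz)
      convert! hpow.mul hrp using 1
      refine ContinuousLinearMap.ext fun y => ?_
      simp only [pairCLM_apply, hgψ, htψ, inner_sub_left, real_inner_smul_left, id,
        add_apply, smul_apply, smul_eq_mul,
        Function.comp_apply]
      ring
    · have hz' : z.2 < R⁻¹ := (not_lt.1 hz).trans_lt (inv_pos.2 hR0)
      have h0 : φ z = 0 := logCutoff_eq_zero_of_time_le hR hz'.le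
      have hev : ψ =ᶠ[nhds z] fun _ => 0 := by
        filter_upwards [(isOpen_lt continuous_snd continuous_const).mem_nhds hz'] with y hy
        have : φ y = 0 := logCutoff_eq_zero_of_time_le hR (le_of_lt hy)
        simp [hψ, this, hs0]
      have h3 : pairCLM (gψ z) (tψ z) = 0 := by
        refine ContinuousLinearMap.ext fun y => ?_
        simp [pairCLM_apply, hgψ, htψ, h0, hs0, hs1]
      rw [h3]
      exact (hasFDerivAt_const 0 z).congr_of_eventuallyEq hev
  have hweak := hu.weak_ineq ψ gψ tψ hψnn hψLip hψc hψS hψd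
  obtain ⟨hξi, hξ0⟩ := integral_fderiv_time_eq_zero haLip ha0 hξLip hξc hξS
  have htime : ∫ z, tψ z * u z ∂muS a
      = ∫ z, s * φ z ^ (s - 1) * timeDeriv φ z * Ψ (u z) ∂muS a := by
    refine Eq.trans ?_ (integral_add_of_integral_eq_zero hξi hξ0)
    refine integral_congr_ae (hac.ae_le ?_)
    filter_upwards [ae_restrict_of_ae hφd, hud, ae_restrict_mem (isOpen_Sset N).measurableSet]
      with z h1 h2 hz
    have hw : 0 < u z + δ := by linarith [hu.nonneg z hz]
    have hpow := (hasDerivAt_pow s (φ z)).comp_hasFDerivAt z h1.hasFDerivAt_pairCLM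
    have hshift := (hasDerivAt_id (u z)).add_const δ
    have hΘ := ((hasDerivAt_id (u z)).mul (hshift.rpow_const (p := -σ) (Or.inl hw.ne'))).sub
      (((hshift.rpow_const (p := 1 - σ) (Or.inl hw.ne')).sub_const (δ ^ (1 - σ))).div_const
        (1 - σ))
    have hder := (hpow.mul (hΘ.comp_hasFDerivAt z h2)).fderiv
    have hder' : fderiv ℝ ξ z (0, 1) = s * φ z ^ (s - 1) * timeDeriv φ z
          * (u z * (u z + δ) ^ (-σ) - Ψ (u z))
        + φ z ^ s * (-σ * u z * (u z + δ) ^ (-σ - 1)) * ut z := by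
      refine (congrArg (fun L => L ((0 : Euc N), (1 : ℝ))) hder).trans ?_
      simp only [pairCLM_apply, id, add_apply, smul_apply,
        smul_eq_mul, Function.comp_apply, inner_zero_right, hΨ, Pi.mul_apply, Pi.sub_apply]
      rw [show (1 : ℝ) - σ - 1 = -σ by ring]
      field_simp
      ring
    have hkey : tψ z * u z = s * φ z ^ (s - 1) * timeDeriv φ z * Ψ (u z)
        + fderiv ℝ ξ z (0, 1) := by
      rw [hder', htψ]; ring
    exact hkey
  have hint : Integrable (fun z => ψ z * u z ^ q * V z) (muS a) := by
    have hK := hu.int_uqV.integrableOn_compact_subset hψS hψc.isCompact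
    have h1 := hK.continuousOn_mul hψLip.continuous.continuousOn hψc.isCompact
    have h2 := (integrableOn_iff_integrable_of_support_subset (fun z hz => by
      refine subset_tsupport _ ?_
      exact left_ne_zero_of_mul hz)).1 h1
    exact h2.congr (Filter.Eventually.of_forall fun z => by simp only [hψ, hφ, mul_assoc])
  have hpos : 0 ≤ᵐ[muS a] fun z => ψ z * u z ^ q * V z := by
    refine hac.ae_le ?_
    filter_upwards [hV, ae_restrict_mem (isOpen_Sset N).measurableSet] with z h1 hz
    have := hu.nonneg z hz
    have := hψnn z
    simp only [Pi.zero_apply]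
    positivity
  have hflux : ∫⁻ z, ENNReal.ofReal
        (⟪gψ z, gu z⟫ * u z ^ (m - 1) * ‖gu z‖ ^ (p - 2) * f ‖gu z‖) ∂muS a
      ≤ ∫⁻ z, ENNReal.ofReal (K * s ^ p * σ ^ (-(p - 1)) * ‖spaceGrad φ z‖ ^ p
          * φ z ^ ((s : ℝ) - p) * (u z + δ) ^ (p + m - 2) * (u z + δ) ^ (-σ)) ∂muS a := by
    refine lintegral_mono_ae (hac.ae_le ?_)
    filter_upwards [ae_restrict_mem (isOpen_Sset N).measurableSet] with z hz
    have h0 := hu.nonneg z hz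
    exact ENNReal.ofReal_le_ofReal (flux_le (spaceGrad φ z) (gu z) hp hm hσ (logCutoff_nonneg z) hs
      h0 (by linarith) (by linarith) (hf _ (norm_nonneg _)).1 (hf _ (norm_nonneg _)).2)
  have htime' : ∫⁻ z, ENNReal.ofReal (-(s * φ z ^ (s - 1) * timeDeriv φ z * Ψ (u z))) ∂muS a
      ≤ ∫⁻ z, ENNReal.ofReal (s * φ z ^ (s - 1)
          * max 0 (-timeDeriv φ z) * (2 * (u z + δ) * (u z + δ) ^ (-σ))) ∂muS a := by
    refine lintegral_mono_ae (hac.ae_le ?_)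
    filter_upwards [ae_restrict_mem (isOpen_Sset N).measurableSet] with z hz
    have h0 := hu.nonneg z hz
    obtain ⟨h1, h2⟩ := rpow_primitive_bounds hσ' hδ (le_add_of_nonneg_left h0 : δ ≤ u z + δ)
    have hφ0 : 0 ≤ φ z := logCutoff_nonneg z
    refine ENNReal.ofReal_le_ofReal ?_
    calc -(s * φ z ^ (s - 1) * timeDeriv φ z * Ψ (u z))
        = s * φ z ^ (s - 1) * (-timeDeriv φ z) * Ψ (u z) := by ring
      _ ≤ s * φ z ^ (s - 1) * max 0 (-timeDeriv φ z) * Ψ (u z) := by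
          gcongr
          exact le_max_right _ _
      _ ≤ _ := by gcongr
  calc ∫⁻ z, ENNReal.ofReal (ψ z * u z ^ q * V z) ∂muS a
      = ENNReal.ofReal (∫ z, ψ z * u z ^ q * V z ∂muS a) :=
        (ofReal_integral_eq_lintegral_ofReal hint hpos).symm
    _ ≤ ENNReal.ofReal (∫ z, ⟪gψ z, gu z⟫ * u z ^ (m - 1) * ‖gu z‖ ^ (p - 2) * f ‖gu z‖ ∂muS a)
        + ENNReal.ofReal (∫ z, -(s * φ z ^ (s - 1) * timeDeriv φ z * Ψ (u z)) ∂muS a) := by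
        rw [htime] at hweak
        rw [integral_neg]
        exact (ENNReal.ofReal_le_ofReal (by linarith)).trans ENNReal.ofReal_add_le
    _ ≤ _ := add_le_add ((ofReal_integral_le_lintegral_ofReal _).trans hflux)
        ((ofReal_integral_le_lintegral_ofReal _).trans htime')

/-- A bootstrap principle: an absorbing estimate that improves at infinity forces the limit
integrand to vanish. -/
lemma lintegral_eq_zero_of_absorbing_estimate {X : Type*} [MeasurableSpace X] {μ : Measure X}
    {F : X → ℝ≥0∞} {Φ : ℕ → X → ℝ≥0∞} {T : ℕ → Set X} {ε : ℕ → ℝ≥0∞} {G : ℝ → ℝ≥0∞} {M : ℝ≥0∞}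
    (hF : AEMeasurable F μ) (hΦ : ∀ n, AEMeasurable (Φ n) μ) (hT : ∀ n, MeasurableSet (T n))
    (hlim : ∀ᵐ z ∂μ, Filter.Tendsto (fun n => Φ n z) Filter.atTop (nhds (F z)))
    (hM : M ≠ ∞) (hdom : ∀ᶠ n in Filter.atTop, ∀ᵐ z ∂μ, Φ n z ≤ M * F z)
    (hfin : ∀ᶠ n in Filter.atTop, ∫⁻ z, Φ n z ∂μ ≠ ∞)
    (hTlim : ∀ z, ∀ᶠ n in Filter.atTop, z ∉ T n)
    (hε : Filter.Tendsto ε Filter.atTop (nhds 0)) (hGfin : ∀ lam, 0 < lam → G lam ≠ ∞)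
    (hG : Filter.Tendsto G Filter.atTop (nhds 0))
    (hmain : ∀ᶠ n in Filter.atTop, ∀ lam : ℝ, 0 < lam →
      ∫⁻ z, Φ n z ∂μ ≤ ENNReal.ofReal lam * (∫⁻ z in T n, Φ n z ∂μ + ε n) + G lam) :
    ∫⁻ z, F z ∂μ = 0 := by
  have hfatou : ∫⁻ z, F z ∂μ ≤ Filter.liminf (fun n => ∫⁻ z, Φ n z ∂μ) Filter.atTop := by
    refine le_trans (lintegral_mono_ae ?_) (lintegral_liminf_le' hΦ)
    filter_upwards [hlim] with z hz using hz.liminf_eq.ge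
  have hFfin : ∫⁻ z, F z ∂μ ≠ ∞ := by
    have hg := hGfin (1 / 2) (by norm_num)
    refine ne_top_of_le_ne_top (b := 1 + 2 * G (1 / 2)) (by finiteness) (hfatou.trans ?_)
    refine (Filter.liminf_le_liminf ?_).trans_eq
      (tendsto_const_nhds (x := 1 + 2 * G (1 / 2)) (f := (Filter.atTop : Filter ℕ))).liminf_eq
    filter_upwards [hmain, hfin, hε.eventually_le_const zero_lt_one] with n h1 h2 h3
    have h4 : ∫⁻ z, Φ n z ∂μ ≤ 2⁻¹ * (∫⁻ z, Φ n z ∂μ + 1) + G (1 / 2) := by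
      refine (h1 (1 / 2) (by norm_num)).trans ?_
      rw [one_div, ENNReal.ofReal_inv_of_pos two_pos, ENNReal.ofReal_ofNat]
      gcongr
      exact Measure.restrict_le_self
    generalize ∫⁻ z, Φ n z ∂μ = Y at h2 h4 ⊢
    generalize G (1 / 2) = g at hg h4 ⊢
    lift Y to NNReal using h2
    lift g to NNReal using hg
    rw [show (2⁻¹ : ℝ≥0∞) = ((2⁻¹ : NNReal) : ℝ≥0∞) by simp] at h4
    norm_cast at h4 ⊢
    rw [← NNReal.coe_le_coe] at h4 ⊢
    push_cast at h4 ⊢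
    linarith
  have htail : Filter.Tendsto (fun n => ∫⁻ z in T n, F z ∂μ) Filter.atTop (nhds 0) := by
    have h := tendsto_lintegral_of_dominated_convergence' (μ := μ)
      (F := fun n => (T n).indicator F) (f := fun _ => 0) F
      (fun n => hF.indicator (hT n))
      (fun n => Filter.Eventually.of_forall fun z => indicator_le_self _ _ _) hFfin
      (Filter.Eventually.of_forall fun z => by
        refine tendsto_const_nhds.congr' ?_
        filter_upwards [hTlim z] with n hn
        rw [indicator_of_notMem hn])
    simpa only [lintegral_indicator (hT _), lintegral_zero] using h
  have hle : ∀ lam : ℝ, 0 < lam → ∫⁻ z, F z ∂μ ≤ G lam := by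
    intro lam hlam
    refine hfatou.trans ?_
    have hlim' : Filter.Tendsto (fun n => ENNReal.ofReal lam *
        (M * ∫⁻ z in T n, F z ∂μ + ε n) + G lam) Filter.atTop (nhds (G lam)) := by
      have h1 := ENNReal.Tendsto.const_mul (a := M) htail (Or.inr hM)
      have h2 := ENNReal.Tendsto.const_mul (a := ENNReal.ofReal lam) (h1.add hε)
        (Or.inr ENNReal.ofReal_ne_top)
      simpa using h2.add_const (G lam)
    refine (Filter.liminf_le_liminf ?_).trans_eq hlim'.liminf_eq
    filter_upwards [hmain, hdom] with n h1 h2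
    refine (h1 lam hlam).trans ?_
    gcongr
    rw [← lintegral_const_mul' _ _ hM]
    exact lintegral_mono_ae (ae_restrict_of_ae h2)
  refine le_antisymm (ge_of_tendsto hG ?_) bot_le
  filter_upwards [Filter.eventually_gt_atTop 0] with lam hlam using hle lam hlam
lemma one_le_log_of_three_le {R : ℝ} (hR : 3 ≤ R) : 1 ≤ log R := by
  rw [Real.le_log_iff_exp_le (by linarith)]
  linarith [Real.exp_one_lt_three]

/-- Dyadic summation over the annulus `R ≤ ‖x‖ ≤ R²` of a density with growth
`R ^ σ * (log R) ^ b` on balls, against the critical weight `‖x‖ ^ (-σ)`. -/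
lemma lintegral_annulus_le {E : Type*} [NormedAddCommGroup E] [MeasurableSpace E] [BorelSpace E]
    {μ : Measure E} {g : E → ℝ≥0∞} {b σ C R₁ R : ℝ} (hb : 0 ≤ b) (hσ : 0 ≤ σ) (hC : 0 ≤ C)
    (h : ∀ r, R₁ ≤ r → ∫⁻ x in ball 0 r, g x ∂μ ≤ ENNReal.ofReal (C * r ^ σ * log r ^ b))
    (hR : 3 ≤ R) (hR₁ : R₁ ≤ R) :
    ∫⁻ x in {x | R ≤ ‖x‖ ∧ ‖x‖ ≤ R ^ 2}, ENNReal.ofReal (‖x‖ ^ (-σ)) * g x ∂μ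
      ≤ ENNReal.ofReal (3 * (C * 2 ^ σ * 3 ^ b) * log R ^ (b + 1)) := by
  have hR0 : 0 < R := by linarith
  have hlog := one_le_log_of_three_le hR
  have hlog2 : 0 < log 2 := Real.log_pos one_lt_two
  set n : ℕ := ⌊log R / log 2⌋₊ + 1 with hn
  have hnR : (n : ℝ) ≤ 3 * log R := by
    have h1 : ((⌊log R / log 2⌋₊ : ℕ) : ℝ) ≤ log R / log 2 := Nat.floor_le (by positivity)
    have h2 : log R / log 2 ≤ 2 * log R := by
      rw [div_le_iff₀ hlog2]
      nlinarith [Real.log_two_gt_d9]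
    rw [hn]; push_cast; linarith
  have hkR : ∀ k < n, (2 : ℝ) ^ k ≤ R := by
    intro k hk
    have h1 : (k : ℝ) ≤ log R / log 2 :=
      (Nat.le_floor_iff (by positivity)).1 (Nat.lt_succ_iff.1 hk)
    rw [le_div_iff₀ hlog2, ← Real.log_pow] at h1
    exact (Real.log_le_log_iff (by positivity) hR0).1 h1
  have hnR' : R < 2 ^ n := by
    have h1 : log R / log 2 < n := by rw [hn]; push_cast; exact Nat.lt_floor_add_one _
    rw [div_lt_iff₀ hlog2, ← Real.log_pow] at h1
    exact (Real.log_lt_log_iff hR0 (by positivity)).1 h1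
  set S : ℕ → Set E := fun k => {x | 2 ^ k * R ≤ ‖x‖ ∧ ‖x‖ < 2 ^ (k + 1) * R} with hS
  have hSm : ∀ k, MeasurableSet (S k) := fun k =>
    (measurableSet_le measurable_const measurable_norm).inter
      (measurableSet_lt measurable_norm measurable_const)
  have hcover : {x : E | R ≤ ‖x‖ ∧ ‖x‖ ≤ R ^ 2} ⊆ ⋃ k : Fin n, S k := by
    rintro x ⟨hx1, hx2⟩
    have hex : ∃ k, ‖x‖ < 2 ^ (k + 1) * R := by
      refine ⟨n, ?_⟩
      have : (2 : ℝ) ^ n ≤ 2 ^ (n + 1) := pow_le_pow_right₀ one_le_two n.le_succ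
      nlinarith
    obtain ⟨k, hk, hmin⟩ : ∃ k, ‖x‖ < 2 ^ (k + 1) * R ∧ ∀ j < k, ¬ ‖x‖ < 2 ^ (j + 1) * R := by
      classical
      exact ⟨Nat.find hex, Nat.find_spec hex, fun j => Nat.find_min hex⟩
    have hkn : k < n := by
      by_contra hkn
      refine hmin (n - 1) (by omega) ?_
      rw [Nat.sub_add_cancel (by omega)]
      nlinarith
    refine mem_iUnion.2 ⟨⟨k, hkn⟩, ?_, hk⟩
    cases k with
    | zero => simpa using hx1
    | succ j => exact not_lt.1 (hmin j j.lt_succ_self)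
  have hshell : ∀ k : Fin n, ∫⁻ x in S k, ENNReal.ofReal (‖x‖ ^ (-σ)) * g x ∂μ
      ≤ ENNReal.ofReal (C * 2 ^ σ * 3 ^ b * log R ^ b) := by
    rintro ⟨k, hk⟩
    have hk' := hkR k hk
    have hk1 : (1 : ℝ) ≤ 2 ^ k := one_le_pow₀ one_le_two
    set r : ℝ := 2 ^ k * R with hr
    have hr0 : 0 < r := by positivity
    have hr2 : 2 ^ (k + 1) * R = 2 * r := by rw [hr]; ring
    calc ∫⁻ x in S k, ENNReal.ofReal (‖x‖ ^ (-σ)) * g x ∂μ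
        ≤ ∫⁻ x in S k, ENNReal.ofReal (r ^ (-σ)) * g x ∂μ := by
          refine setLIntegral_mono' (hSm k) fun x hx => ?_
          gcongr ENNReal.ofReal ?_ * _
          exact Real.rpow_le_rpow_of_nonpos hr0 hx.1 (by linarith)
      _ = ENNReal.ofReal (r ^ (-σ)) * ∫⁻ x in S k, g x ∂μ :=
          lintegral_const_mul' _ _ ENNReal.ofReal_ne_top
      _ ≤ ENNReal.ofReal (r ^ (-σ)) * ∫⁻ x in ball 0 (2 * r), g x ∂μ := by
          gcongr
          intro x hx
          rw [mem_ball_zero_iff, ← hr2]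
          exact hx.2
      _ ≤ ENNReal.ofReal (r ^ (-σ)) * ENNReal.ofReal (C * (2 * r) ^ σ * log (2 * r) ^ b) := by
          gcongr
          refine h _ ?_
          nlinarith
      _ ≤ _ := by
          rw [← ENNReal.ofReal_mul (by positivity)]
          refine ENNReal.ofReal_le_ofReal ?_
          have h1 : log (2 * r) ≤ 3 * log R := by
            rw [show 3 * log R = log (R ^ 3) by rw [Real.log_pow]; norm_num]
            refine Real.log_le_log (by positivity) ?_
            rw [hr]
            nlinarith [mul_le_mul_of_nonneg_right hk' hR0.le, sq_nonneg R]
          have h2 : 0 ≤ log (2 * r) := Real.log_nonneg (by nlinarith)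
          calc r ^ (-σ) * (C * (2 * r) ^ σ * log (2 * r) ^ b)
              = C * 2 ^ σ * log (2 * r) ^ b := by
                rw [Real.mul_rpow zero_le_two hr0.le, Real.rpow_neg hr0.le]
                field_simp
            _ ≤ C * 2 ^ σ * (3 * log R) ^ b := by gcongr
            _ = _ := by rw [Real.mul_rpow (by norm_num) (by linarith)]; ring
  calc ∫⁻ x in {x | R ≤ ‖x‖ ∧ ‖x‖ ≤ R ^ 2}, ENNReal.ofReal (‖x‖ ^ (-σ)) * g x ∂μ
      ≤ ∫⁻ x in ⋃ k : Fin n, S k, ENNReal.ofReal (‖x‖ ^ (-σ)) * g x ∂μ :=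
        lintegral_mono_set hcover
    _ ≤ ∑' k : Fin n, ∫⁻ x in S k, ENNReal.ofReal (‖x‖ ^ (-σ)) * g x ∂μ :=
        lintegral_iUnion_le _ _
    _ ≤ ∑ k : Fin n, ENNReal.ofReal (C * 2 ^ σ * 3 ^ b * log R ^ b) :=
        (tsum_fintype _).trans_le (Finset.sum_le_sum fun k _ => hshell k)
    _ = ENNReal.ofReal (n * (C * 2 ^ σ * 3 ^ b * log R ^ b)) := by
        rw [Finset.sum_const, Finset.card_univ, Fintype.card_fin, nsmul_eq_mul, ENNReal.ofReal_mul n.cast_nonneg,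
          ENNReal.ofReal_natCast]
    _ ≤ _ := by
        refine ENNReal.ofReal_le_ofReal ?_
        rw [Real.rpow_add (by linarith), Real.rpow_one]
        calc n * (C * 2 ^ σ * 3 ^ b * log R ^ b)
            ≤ (3 * log R) * (C * 2 ^ σ * 3 ^ b * log R ^ b) := by gcongr
          _ = _ := by ring
/-- Critical weighted estimate over the region where the spatial gradient of the cutoff lives. -/
lemma lintegral_prod_space_tail_le {E : Type*} [NormedAddCommGroup E] [MeasurableSpace E]
    [BorelSpace E] {μ : Measure E} [SFinite μ] {g : E → ℝ≥0∞} {b σ γ C R₁ R : ℝ} (hb : 0 ≤ b)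
    (hσ : 0 ≤ σ) (hC : 0 ≤ C)
    (h : ∀ r, R₁ ≤ r → ∫⁻ x in ball 0 r, g x ∂μ ≤ ENNReal.ofReal (C * r ^ σ * log r ^ b))
    (hR : 3 ≤ R) (hR₁ : R₁ ≤ R) :
    ∫⁻ z in {z : E × ℝ | R ≤ ‖z.1‖ ∧ ‖z.1‖ ≤ R ^ 2 ∧ z.2 ≤ ‖z.1‖ ^ γ},
        ENNReal.ofReal (‖z.1‖ ^ (-(σ + γ))) * g z.1 ∂μ.prod (volume.restrict (Ioi (0 : ℝ)))
      ≤ ENNReal.ofReal (3 * (C * 2 ^ σ * 3 ^ b) * log R ^ (b + 1)) := by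
  have hR0 : 0 < R := by linarith
  have hA : MeasurableSet {z : E × ℝ | R ≤ ‖z.1‖ ∧ ‖z.1‖ ≤ R ^ 2 ∧ z.2 ≤ ‖z.1‖ ^ γ} := by
    simp only [ofPred_and]
    exact (measurableSet_le (by fun_prop) (by fun_prop)).inter
      ((measurableSet_le (by fun_prop) (by fun_prop)).inter
        (measurableSet_le (by fun_prop) (by fun_prop)))
  have hB : MeasurableSet {x : E | R ≤ ‖x‖ ∧ ‖x‖ ≤ R ^ 2} := by
    simp only [ofPred_and]
    exact (measurableSet_le (by fun_prop) (by fun_prop)).inter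
      (measurableSet_le (by fun_prop) (by fun_prop))
  refine le_trans ?_ (lintegral_annulus_le hb hσ hC h hR hR₁)
  rw [← lintegral_indicator hA, ← lintegral_indicator hB]
  refine (lintegral_prod_le _).trans (lintegral_mono fun x => ?_)
  by_cases hx : x ∈ {x : E | R ≤ ‖x‖ ∧ ‖x‖ ≤ R ^ 2}
  · have hx0 : 0 < ‖x‖ := hR0.trans_le hx.1
    rw [indicator_of_mem hx]
    calc _ ≤ ∫⁻ t in Ioi (0 : ℝ), (Iic (‖x‖ ^ γ)).indicator
            (fun _ => ENNReal.ofReal (‖x‖ ^ (-(σ + γ))) * g x) t := by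
          refine lintegral_mono fun t => ?_
          by_cases ht : t ≤ ‖x‖ ^ γ
          · rw [indicator_of_mem (show t ∈ Iic (‖x‖ ^ γ) from ht)]
            exact indicator_le_self _ _ _
          · rw [indicator_of_notMem (fun hz => ht hz.2.2)]
            exact bot_le
      _ = ENNReal.ofReal (‖x‖ ^ (-(σ + γ))) * g x * ENNReal.ofReal (‖x‖ ^ γ) := by
          rw [lintegral_indicator_const measurableSet_Iic,
            Measure.restrict_apply measurableSet_Iic, inter_comm, Ioi_inter_Iic, Real.volume_Ioc,
            sub_zero]
      _ = _ := by
          rw [mul_right_comm, ← ENNReal.ofReal_mul (by positivity), ← Real.rpow_add hx0]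
          congr 3
          ring
  · rw [indicator_of_notMem hx]
    refine (lintegral_congr fun t => indicator_of_notMem (fun ht => hx ⟨ht.1, ht.2.1⟩) _).trans_le ?_
    simp

/-- Critical weighted estimate over the region where the time derivative of the cutoff lives. -/
lemma lintegral_prod_time_tail_le {E : Type*} [NormedAddCommGroup E] [MeasurableSpace E]
    [BorelSpace E] {μ : Measure E} [SFinite μ] {g : E → ℝ≥0∞} (hg : Measurable g)
    {b σ γ C R₁ R : ℝ} (hb : 0 ≤ b) (hC : 0 ≤ C) (hγ : 0 < γ) (hσγ : σ ≤ b * γ)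
    (h : ∀ r, R₁ ≤ r → ∫⁻ x in ball 0 r, g x ∂μ ≤ ENNReal.ofReal (C * r ^ σ * log r ^ b))
    (hR : 3 ≤ R) (hR₁ : R₁ ≤ R) :
    ∫⁻ z in {z : E × ℝ | R ^ γ ≤ z.2 ∧ z.2 ≤ R ^ (2 * γ) ∧ ‖z.1‖ ^ γ ≤ z.2},
        ENNReal.ofReal (z.2 ^ (-(b + 1))) * g z.1 ∂μ.prod (volume.restrict (Ioi (0 : ℝ)))
      ≤ ENNReal.ofReal (γ * (C * 2 ^ σ * 3 ^ b) * log R ^ (b + 1)) := by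
  have hR0 : 0 < R := by linarith
  have hlog := one_le_log_of_three_le hR
  have hA : MeasurableSet
      {z : E × ℝ | R ^ γ ≤ z.2 ∧ z.2 ≤ R ^ (2 * γ) ∧ ‖z.1‖ ^ γ ≤ z.2} := by
    simp only [ofPred_and]
    exact (measurableSet_le (by fun_prop) (by fun_prop)).inter
      ((measurableSet_le (by fun_prop) (by fun_prop)).inter
        (measurableSet_le (by fun_prop) (by fun_prop)))
  rw [← lintegral_indicator hA, lintegral_prod_symm _
    ((Measurable.indicator (by fun_prop) hA).aemeasurable)]
  have hcle : R ^ γ ≤ R ^ (2 * γ) :=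
    Real.rpow_le_rpow_of_exponent_le (by linarith) (by linarith)
  set c : ℝ := C * 2 ^ σ * 3 ^ b * log R ^ b with hc
  have hc0 : 0 ≤ c := by positivity
  calc _ ≤ ∫⁻ t in Ioi (0 : ℝ),
          (Icc (R ^ γ) (R ^ (2 * γ))).indicator (fun t => ENNReal.ofReal (c * t⁻¹)) t := by
        refine lintegral_mono fun t => ?_
        by_cases ht : t ∈ Icc (R ^ γ) (R ^ (2 * γ))
        · have ht0 : 0 < t := (by positivity : 0 < R ^ γ).trans_le ht.1
          rw [indicator_of_mem ht]
          set r : ℝ := t ^ γ⁻¹ with hr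
          have hrt : r ^ γ = t := by rw [hr, ← Real.rpow_mul ht0.le, inv_mul_cancel₀ hγ.ne', rpow_one]
          have hr0 : 0 < r := by positivity
          have hrR : R ≤ r := by
            rw [← Real.rpow_le_rpow_iff hR0.le hr0.le hγ, hrt]; exact ht.1
          have hrR' : r ≤ R ^ 2 := by
            rw [← Real.rpow_le_rpow_iff hr0.le (by positivity) hγ, hrt, ← Real.rpow_natCast,
              ← Real.rpow_mul hR0.le]
            exact_mod_cast ht.2
          calc _ ≤ ∫⁻ x, (ball (0 : E) (2 * r)).indicator
                  (fun x => ENNReal.ofReal (t ^ (-(b + 1))) * g x) x ∂μ := by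
                refine lintegral_mono fun x => ?_
                by_cases hx : ‖x‖ ^ γ ≤ t
                · have hx' : x ∈ ball (0 : E) (2 * r) := by
                    rw [← hrt, Real.rpow_le_rpow_iff (norm_nonneg _) hr0.le hγ] at hx
                    rw [mem_ball_zero_iff]
                    linarith
                  rw [indicator_of_mem hx']
                  exact indicator_le_self _ _ _
                · rw [indicator_of_notMem (fun hz => hx hz.2.2)]
                  exact bot_le
            _ = ENNReal.ofReal (t ^ (-(b + 1))) * ∫⁻ x in ball (0 : E) (2 * r), g x ∂μ := by
                rw [lintegral_indicator measurableSet_ball,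
                  lintegral_const_mul' _ _ ENNReal.ofReal_ne_top]
            _ ≤ ENNReal.ofReal (t ^ (-(b + 1)))
                  * ENNReal.ofReal (C * (2 * r) ^ σ * log (2 * r) ^ b) := by
                gcongr
                exact h _ (by linarith)
            _ ≤ _ := by
                rw [← ENNReal.ofReal_mul (by positivity)]
                refine ENNReal.ofReal_le_ofReal ?_
                have h1 : log (2 * r) ≤ 3 * log R := by
                  rw [show 3 * log R = log (R ^ 3) by rw [Real.log_pow]; norm_num]
                  refine Real.log_le_log (by positivity) ?_
                  nlinarith [sq_nonneg R]
                have h2 : 0 ≤ log (2 * r) := Real.log_nonneg (by linarith)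
                have h3 : r ^ σ ≤ t ^ b := by
                  rw [← hrt, ← Real.rpow_mul hr0.le, mul_comm γ b]
                  exact Real.rpow_le_rpow_of_exponent_le (by linarith) hσγ
                calc t ^ (-(b + 1)) * (C * (2 * r) ^ σ * log (2 * r) ^ b)
                    ≤ t ^ (-(b + 1)) * (C * (2 ^ σ * t ^ b) * (3 * log R) ^ b) := by
                      rw [Real.mul_rpow zero_le_two hr0.le]
                      gcongr
                  _ = C * 2 ^ σ * 3 ^ b * log R ^ b * (t ^ (-(b + 1)) * t ^ b) := by
                      rw [Real.mul_rpow (by norm_num) (by linarith)]; ring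
                  _ = c * t⁻¹ := by
                      rw [← Real.rpow_add ht0, ← Real.rpow_neg_one t, hc]
                      congr 2
                      ring
        · rw [indicator_of_notMem ht]
          refine (lintegral_congr fun x =>
            indicator_of_notMem (fun hz => ht ⟨hz.1, hz.2.1⟩) _).trans_le ?_
          simp
    _ ≤ ∫⁻ t in Icc (R ^ γ) (R ^ (2 * γ)), ENNReal.ofReal (c * t⁻¹) := by
        rw [← lintegral_indicator measurableSet_Icc]
        exact lintegral_mono' Measure.restrict_le_self le_rfl
    _ = ENNReal.ofReal (∫ t in Icc (R ^ γ) (R ^ (2 * γ)), c * t⁻¹) := by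
        have hpos : ∀ t ∈ Icc (R ^ γ) (R ^ (2 * γ)), 0 < t := fun t ht =>
          (by positivity : 0 < R ^ γ).trans_le ht.1
        refine (ofReal_integral_eq_lintegral_ofReal ?_ ?_).symm
        · refine ContinuousOn.integrableOn_Icc ?_
          exact continuousOn_const.mul (continuousOn_id.inv₀ fun t ht => (hpos t ht).ne')
        · filter_upwards [ae_restrict_mem measurableSet_Icc] with t ht
          have := hpos t ht
          simp only [Pi.zero_apply]
          positivity
    _ ≤ _ := by
        refine ENNReal.ofReal_le_ofReal (le_of_eq ?_)
        rw [integral_const_mul, integral_Icc_eq_integral_Ioc,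
          ← intervalIntegral.integral_of_le hcle,
          integral_inv_of_pos (by positivity) (by positivity), ← Real.rpow_sub hR0,
          Real.log_rpow hR0, hc, Real.rpow_add (by linarith), Real.rpow_one]
        ring

lemma lintegral_prod_fst_rect {E : Type*} [MeasurableSpace E] {μ : Measure E} [SFinite μ]
    {F : E → ℝ≥0∞} {s : Set E} {c d : ℝ} (hc : 0 ≤ c) :
    ∫⁻ z in s ×ˢ Icc c d, F z.1 ∂μ.prod (volume.restrict (Ioi (0 : ℝ)))
      ≤ (∫⁻ x in s, F x ∂μ) * ENNReal.ofReal d := by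
  rw [← Measure.prod_restrict]
  refine (lintegral_prod_le _).trans ?_
  simp only [lintegral_const]
  have hle : ((volume.restrict (Ioi (0 : ℝ))).restrict (Icc c d)) univ ≤ ENNReal.ofReal d := by
    rw [Measure.restrict_apply_univ]
    refine (Measure.restrict_le_self _).trans ?_
    rw [Real.volume_Icc]
    exact ENNReal.ofReal_le_ofReal (by linarith)
  refine (lintegral_mono fun x => mul_le_mul_right hle _).trans_eq ?_
  rw [lintegral_mul_const' _ _ ENNReal.ofReal_ne_top]
lemma lintegral_rpow_neg_le_of_integral_le {N : ℕ} {a : Euc N → ℝ} (ha : Continuous a)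
    {h : Euc N → ℝ} (hmeas : Measurable h) {C α b r B : ℝ} (hC : 0 < C) (hα : 0 ≤ α) (hb : 0 ≤ b)
    (hh : ∀ᵐ x ∂(volume : Measure (Euc N)), C⁻¹ * (1 + ‖x‖) ^ (-α) ≤ h x)
    (hB : ∫ x in ball (0 : Euc N) r, h x ^ (-b) ∂muA a ≤ B) :
    ∫⁻ x in ball (0 : Euc N) r, ENNReal.ofReal (h x ^ (-b)) ∂muA a ≤ ENNReal.ofReal B := by
  have hh' : ∀ᵐ x ∂(muA a).restrict (ball (0 : Euc N) r), C⁻¹ * (1 + ‖x‖) ^ (-α) ≤ h x :=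
    ae_restrict_of_ae ((withDensity_absolutelyContinuous _ _).ae_le hh)
  have hfin : muA a (ball (0 : Euc N) r) ≠ ∞ := by
    have : IsLocallyFiniteMeasure (muA a) :=
      IsLocallyFiniteMeasure.withDensity_ofReal ha
    exact measure_ball_lt_top.ne
  have hint : IntegrableOn (fun x => h x ^ (-b)) (ball (0 : Euc N) r) (muA a) := by
    refine Measure.integrableOn_of_bounded (M := (C⁻¹ * (1 + r) ^ (-α)) ^ (-b)) hfin
      (hmeas.pow_const _).aestronglyMeasurable ?_
    filter_upwards [hh', ae_restrict_mem measurableSet_ball] with x hx hxr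
    rw [mem_ball_zero_iff] at hxr
    have hr : 0 < 1 + r := by linarith [norm_nonneg x]
    have h1 : C⁻¹ * (1 + r) ^ (-α) ≤ h x := by
      refine le_trans ?_ hx
      gcongr ?_ * ?_
      exact Real.rpow_le_rpow_of_nonpos (by positivity) (by linarith) (by linarith)
    have h2 : 0 < C⁻¹ * (1 + r) ^ (-α) := by positivity
    rw [Real.norm_of_nonneg (Real.rpow_nonneg (h2.le.trans h1) _)]
    exact Real.rpow_le_rpow_of_nonpos h2 h1 (by linarith)
  have hpos : 0 ≤ᵐ[(muA a).restrict (ball (0 : Euc N) r)] fun x => h x ^ (-b) := by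
    filter_upwards [hh'] with x hx
    have : 0 < C⁻¹ * (1 + ‖x‖) ^ (-α) := by positivity
    exact Real.rpow_nonneg (this.le.trans hx) _
  rw [← ofReal_integral_eq_lintegral_ofReal hint hpos]
  exact ENNReal.ofReal_le_ofReal hB

/-- A function of polynomial growth whose negative power has controlled integrals on balls has
itself integrals of polynomial growth. -/
lemma lintegral_closedBall_le_of_growth {E : Type*} [NormedAddCommGroup E] [MeasurableSpace E]
    [BorelSpace E] {μ : Measure E} {h : E → ℝ} {C α b σ R₁ R : ℝ} (hC : 0 < C) (hα : 0 ≤ α)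
    (hb : 0 ≤ b) (hh : ∀ᵐ x ∂μ, 0 < h x ∧ h x ≤ C * (1 + ‖x‖) ^ α)
    (hint : ∀ r, R₁ ≤ r →
      ∫⁻ x in ball 0 r, ENNReal.ofReal (h x ^ (-b)) ∂μ ≤ ENNReal.ofReal (C * r ^ σ * log r ^ b))
    (hR : 3 ≤ R) (hR₁ : R₁ ≤ R) :
    ∫⁻ x in closedBall (0 : E) (R ^ 2), ENNReal.ofReal (h x) ∂μ
      ≤ ENNReal.ofReal (C ^ (1 + b) * C * 3 ^ b * R ^ (3 * α * (1 + b) + 3 * σ + b)) := by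
  have hR0 : 0 < R := by linarith
  have hR3 : 1 + R ^ 2 ≤ R ^ 3 := by nlinarith [sq_nonneg R]
  have hRle : R ≤ R ^ 3 := by nlinarith [sq_nonneg R]
  set c : ℝ := (C * (R ^ 3) ^ α) ^ (1 + b) with hc
  have hc0 : 0 ≤ c := by positivity
  calc ∫⁻ x in closedBall (0 : E) (R ^ 2), ENNReal.ofReal (h x) ∂μ
      ≤ ∫⁻ x in closedBall (0 : E) (R ^ 2),
          ENNReal.ofReal c * ENNReal.ofReal (h x ^ (-b)) ∂μ := by
        refine lintegral_mono_ae ?_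
        filter_upwards [ae_restrict_of_ae hh, ae_restrict_mem measurableSet_closedBall]
          with x hx hxr
        rw [mem_closedBall_zero_iff] at hxr
        rw [← ENNReal.ofReal_mul hc0]
        refine ENNReal.ofReal_le_ofReal ?_
        have h1 : h x ≤ C * (R ^ 3) ^ α := by
          refine hx.2.trans ?_
          gcongr
          linarith
        calc h x = h x ^ (1 + b) * h x ^ (-b) := by
              rw [← Real.rpow_add hx.1, add_neg_cancel_right, Real.rpow_one]
          _ ≤ c * h x ^ (-b) := by
              have := hx.1
              rw [hc]
              gcongr
    _ = ENNReal.ofReal c * ∫⁻ x in closedBall (0 : E) (R ^ 2), ENNReal.ofReal (h x ^ (-b)) ∂μ :=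
        lintegral_const_mul' _ _ ENNReal.ofReal_ne_top
    _ ≤ ENNReal.ofReal c * ENNReal.ofReal (C * (R ^ 3) ^ σ * log (R ^ 3) ^ b) := by
        gcongr
        refine (lintegral_mono_set ?_).trans (hint (R ^ 3) (by linarith))
        exact closedBall_subset_ball (by linarith)
    _ ≤ _ := by
        rw [← ENNReal.ofReal_mul hc0]
        refine ENNReal.ofReal_le_ofReal ?_
        have h1 : log (R ^ 3) ≤ 3 * R := by
          rw [Real.log_pow]
          push_cast
          linarith [Real.log_le_self hR0.le]
        have h2 : 0 ≤ log (R ^ 3) := Real.log_nonneg (by linarith)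
        calc c * (C * (R ^ 3) ^ σ * log (R ^ 3) ^ b)
            ≤ c * (C * (R ^ 3) ^ σ * (3 * R) ^ b) := by gcongr
          _ = C ^ (1 + b) * C * 3 ^ b * (R ^ (3 * α * (1 + b)) * R ^ (3 * σ) * R ^ b) := by
              rw [hc, Real.mul_rpow hC.le (by positivity), Real.mul_rpow (by norm_num) hR0.le,
                ← Real.rpow_natCast, ← Real.rpow_mul hR0.le, ← Real.rpow_mul hR0.le,
                ← Real.rpow_mul hR0.le]
              push_cast
              ring
          _ = _ := by rw [← Real.rpow_add hR0, ← Real.rpow_add hR0]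
instance muA.instSFinite {N : ℕ} (a : Euc N → ℝ) : SFinite (muA a) :=
  inferInstanceAs (SFinite ((volume : Measure (Euc N)).withDensity _))

lemma rpow_neg_one_div_log_le {R M w : ℝ} (hR : 3 ≤ R) (hw : R ^ (-M) ≤ w) :
    w ^ (-(1 / log R)) ≤ exp M := by
  have hR0 : 0 < R := by linarith
  have hlog := one_le_log_of_three_le hR
  have hδ : 0 < R ^ (-M) := by positivity
  refine (Real.rpow_le_rpow_of_nonpos hδ hw (by simp; linarith)).trans_eq ?_
  rw [← Real.rpow_mul hR0.le, Real.rpow_def_of_pos hR0]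
  congr 1
  field_simp

lemma cutoff_mul_rpow_mul_le {b q c d e φ H w lam s y Y : ℝ} (hb : 0 < b) (hbq : b < q)
    (hc : 0 ≤ c) (hcd : c ≤ d) (hφ : 0 ≤ φ) (hφ1 : φ ≤ 1) (hH : 0 < H) (hw : 0 ≤ w)
    (hlam : 0 < lam) (hs : 0 ≤ s) (he : s * (b / q) ≤ e) (hy : 0 ≤ y) (hyY : y ≤ Y) :
    c * φ ^ e * w ^ b * y ≤ lam * (H * w ^ q * φ ^ s * y)
      + lam ^ (-(b / (q - b))) * (Y * d ^ (q / (q - b))) * H ^ (-(b / (q - b))) := by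
  have h := cutoff_mul_rpow_le hb hbq (hc.trans hcd) hφ hφ1 hH hw hlam hs he
  have hd : 0 ≤ d := hc.trans hcd
  calc c * φ ^ e * w ^ b * y ≤ d * φ ^ e * w ^ b * y := by gcongr
    _ ≤ (lam * (H * w ^ q * φ ^ s)
          + lam ^ (-(b / (q - b))) * (d ^ (q / (q - b)) * H ^ (-(b / (q - b))))) * y := by gcongr
    _ = lam * (H * w ^ q * φ ^ s * y)
          + lam ^ (-(b / (q - b))) * (y * d ^ (q / (q - b))) * H ^ (-(b / (q - b))) := by ring
    _ ≤ _ := by gcongr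

/-- The complement of the cylinder `{‖x‖ < R, t < R ^ γ}`. -/
def cylinderCompl (N : ℕ) (R γ : ℝ) : Set (Euc N × ℝ) := {z | R ≤ ‖z.1‖ ∨ R ^ γ ≤ z.2}

lemma measurableSet_cylinderCompl (N : ℕ) (R γ : ℝ) : MeasurableSet (cylinderCompl N R γ) := by
  simp only [cylinderCompl, ofPred_or]
  exact (measurableSet_le (by fun_prop) (by fun_prop)).union
    (measurableSet_le (by fun_prop) (by fun_prop))

lemma ae_differentiableAt_logCutoff {N : ℕ} {R : ℝ} (γ : ℝ) (hR : 1 < R) :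
    ∀ᵐ z ∂(volume : Measure (Euc N × ℝ)), DifferentiableAt ℝ (logCutoff R γ) z := by
  have := ((locallyLipschitz_logCutoff (N := N) (γ := γ) hR).locallyLipschitzOn
    (s := univ)).ae_differentiableAt_of_isOpen (μ := (volume : Measure (Euc N × ℝ))) isOpen_univ
  rwa [Measure.restrict_univ] at this

/-- Absorption of the term containing the spatial gradient of the cutoff. -/
lemma lintegral_gradient_term_le {N : ℕ} {a : Euc N → ℝ} (ha : Measurable a)
    {u : Euc N × ℝ → ℝ} (hu0 : ∀ z ∈ Sset N, 0 ≤ u z) {h : Euc N → ℝ} (hmeas : Measurable h)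
    (hpos : ∀ᵐ z ∂muS a, 0 < h z.1) {p q l K M C σ γ R₁ R lam : ℝ} {s : ℕ} (hp : 1 < p)
    (hl : 0 < l) (hlq : l < q) (hK : 0 ≤ K) (hC : 0 ≤ C) (hσ : 0 ≤ σ) (hγ : 0 < γ)
    (hσγ : σ + γ = p * q / (q - l)) (hs : s * (l / q) ≤ s - p)
    (hint : ∀ r, R₁ ≤ r → ∫⁻ x in ball (0 : Euc N) r, ENNReal.ofReal (h x ^ (-(l / (q - l)))) ∂muA a
      ≤ ENNReal.ofReal (C * r ^ σ * log r ^ (l / (q - l))))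
    (hR : 3 ≤ R) (hR₁ : R₁ ≤ R) (hlam : 0 < lam) :
    ∫⁻ z, ENNReal.ofReal (K * s ^ p * (1 / log R) ^ (-(p - 1)) * ‖spaceGrad (logCutoff R γ) z‖ ^ p
        * logCutoff R γ z ^ ((s : ℝ) - p) * (u z + R ^ (-M)) ^ l
        * (u z + R ^ (-M)) ^ (-(1 / log R))) ∂muS a
      ≤ ENNReal.ofReal lam * ∫⁻ z in cylinderCompl N R γ, ENNReal.ofReal (h z.1
          * (u z + R ^ (-M)) ^ q * logCutoff R γ z ^ s * (u z + R ^ (-M)) ^ (-(1 / log R))) ∂muS a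
        + ENNReal.ofReal (lam ^ (-(l / (q - l))) * (exp M * (K * s ^ p * 2 ^ p) ^ (q / (q - l))
          * (3 * (C * 2 ^ σ * 3 ^ (l / (q - l)))))) := by
  have hR0 : 0 < R := by linarith
  have hR1 : 1 < R := by linarith
  have hlog := one_le_log_of_three_le hR
  have hql : 0 < q - l := by linarith
  have hac := muS_absolutelyContinuous (N := N) ha
  have hexp : l / (q - l) + 1 = q / (q - l) := by field_simp; ring
  set A : Set (Euc N × ℝ) := {z | R ≤ ‖z.1‖ ∧ ‖z.1‖ ≤ R ^ 2 ∧ z.2 ≤ ‖z.1‖ ^ γ} with hA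
  have hAm : MeasurableSet A := by
    simp only [hA, ofPred_and]
    exact (measurableSet_le (by fun_prop) (by fun_prop)).inter
      ((measurableSet_le (by fun_prop) (by fun_prop)).inter
        (measurableSet_le (by fun_prop) (by fun_prop)))
  set c : ℝ := lam ^ (-(l / (q - l))) * (exp M * (K * s ^ p * 2 ^ p) ^ (q / (q - l)))
    * log R ^ (-(q / (q - l))) with hc
  have hc0 : 0 ≤ c := by positivity
  set Z : Euc N × ℝ → ℝ≥0∞ := fun z => ENNReal.ofReal (h z.1 * (u z + R ^ (-M)) ^ q
    * logCutoff R γ z ^ s * (u z + R ^ (-M)) ^ (-(1 / log R))) with hZ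
  set J : Euc N × ℝ → ℝ≥0∞ := fun z => ENNReal.ofReal (‖z.1‖ ^ (-(σ + γ)))
    * ENNReal.ofReal (h z.1 ^ (-(l / (q - l)))) with hJ
  have hJm : Measurable J := by fun_prop
  calc _ ≤ ∫⁻ z, A.indicator (fun z => ENNReal.ofReal lam * Z z + ENNReal.ofReal c * J z) z
          ∂muS a := by
        refine lintegral_mono_ae ?_
        filter_upwards [hac.ae_le (ae_restrict_of_ae (ae_differentiableAt_logCutoff γ hR1)),
          hac.ae_le (ae_restrict_mem (isOpen_Sset N).measurableSet), hpos] with z hd hz hH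
        have hu := hu0 z hz
        have hδ : 0 < R ^ (-M) := by positivity
        have hφ := logCutoff_nonneg (R := R) (γ := γ) z
        have hφ1 := logCutoff_le_one (γ := γ) hR1 z
        by_cases hv : spaceGrad (logCutoff R γ) z = 0
        · rw [hv, norm_zero, Real.zero_rpow (by linarith)]
          simp
        · obtain ⟨h1, h2, h3, h4⟩ := logCutoff_space_deriv hR1 hγ hd.hasFDerivAt_pairCLM hv
          have hx0 : 0 < ‖z.1‖ := hR0.trans_le h1
          rw [indicator_of_mem (show z ∈ A from ⟨h1, h2, h3⟩)]
          simp only [hZ, hJ]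
          rw [← ENNReal.ofReal_mul hlam.le, ← ENNReal.ofReal_mul (by positivity),
            ← ENNReal.ofReal_mul hc0, ← ENNReal.ofReal_add (by positivity) (by positivity)]
          refine ENNReal.ofReal_le_ofReal ?_
          have hcd : K * s ^ p * (1 / log R) ^ (-(p - 1)) * ‖spaceGrad (logCutoff R γ) z‖ ^ p
              ≤ K * s ^ p * 2 ^ p * (log R)⁻¹ * ‖z.1‖ ^ (-p) := by
            calc _ ≤ K * s ^ p * (1 / log R) ^ (-(p - 1)) * (2 / (‖z.1‖ * log R)) ^ p := by gcongr
              _ = _ := by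
                have hl0 : 0 < log R := by linarith
                rw [Real.div_rpow zero_le_two (by positivity), Real.mul_rpow hx0.le hl0.le, one_div,
                  Real.inv_rpow hl0.le, Real.rpow_neg hl0.le, inv_inv, Real.rpow_sub_one hl0.ne',
                  Real.rpow_neg hx0.le]
                field_simp
          have key := cutoff_mul_rpow_mul_le hl hlq (by positivity) hcd hφ hφ1 hH
            (by positivity : 0 ≤ u z + R ^ (-M)) hlam s.cast_nonneg hs (by positivity)
            (rpow_neg_one_div_log_le (M := M) hR (le_add_of_nonneg_left hu))
          refine key.trans_eq ?_
          rw [Real.rpow_natCast, hc, Real.mul_rpow (by positivity) (by positivity),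
            Real.mul_rpow (by positivity) (by positivity), Real.inv_rpow (by positivity),
            ← Real.rpow_neg (by positivity), ← Real.rpow_mul hx0.le, hσγ]
          rw [show -p * (q / (q - l)) = -(p * q / (q - l)) by ring]
          ring
    _ = ENNReal.ofReal lam * ∫⁻ z in A, Z z ∂muS a + ENNReal.ofReal c * ∫⁻ z in A, J z ∂muS a := by
        rw [lintegral_indicator hAm, lintegral_add_right _ (hJm.const_mul _),
          lintegral_const_mul' _ _ ENNReal.ofReal_ne_top,
          lintegral_const_mul' _ _ ENNReal.ofReal_ne_top]
    _ ≤ ENNReal.ofReal lam * ∫⁻ z in cylinderCompl N R γ, Z z ∂muS a + ENNReal.ofReal c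
          * ENNReal.ofReal (3 * (C * 2 ^ σ * 3 ^ (l / (q - l))) * log R ^ (l / (q - l) + 1)) := by
        gcongr
        · exact fun z hz => Or.inl hz.1
        · exact lintegral_prod_space_tail_le (div_nonneg hl.le hql.le) hσ hC hint hR hR₁
    _ = _ := by
        rw [← ENNReal.ofReal_mul hc0]
        congr 2
        have h1 : log R ^ (-(q / (q - l))) * log R ^ (q / (q - l)) = 1 := by
          rw [← Real.rpow_add (by linarith), neg_add_cancel, Real.rpow_zero]
        rw [hc, hexp]
        linear_combination (lam ^ (-(l / (q - l))) * (exp M * (K * s ^ p * 2 ^ p) ^ (q / (q - l)))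
          * (3 * (C * 2 ^ σ * 3 ^ (l / (q - l))))) * h1

/-- Absorption of the term containing the time derivative of the cutoff. -/
lemma lintegral_time_term_le {N : ℕ} {a : Euc N → ℝ} (ha : Measurable a)
    {u : Euc N × ℝ → ℝ} (hu0 : ∀ z ∈ Sset N, 0 ≤ u z) {h : Euc N → ℝ} (hmeas : Measurable h)
    (hpos : ∀ᵐ z ∂muS a, 0 < h z.1) {q M C σ γ R₁ R lam : ℝ} {s : ℕ}
    (hq : 1 < q) (hC : 0 ≤ C) (hγ : 0 < γ) (hσγ : σ ≤ 1 / (q - 1) * γ)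
    (hs0 : 1 ≤ s) (hs : s * (1 / q) ≤ s - 1)
    (hint : ∀ r, R₁ ≤ r → ∫⁻ x in ball (0 : Euc N) r, ENNReal.ofReal (h x ^ (-(1 / (q - 1)))) ∂muA a
      ≤ ENNReal.ofReal (C * r ^ σ * log r ^ (1 / (q - 1))))
    (hR : 3 ≤ R) (hR₁ : R₁ ≤ R) (hlam : 0 < lam) :
    ∫⁻ z, ENNReal.ofReal (s * logCutoff R γ z ^ (s - 1)
        * max 0 (-timeDeriv (logCutoff R γ) z) * (2 * (u z + R ^ (-M))
        * (u z + R ^ (-M)) ^ (-(1 / log R)))) ∂muS a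
      ≤ ENNReal.ofReal lam * ∫⁻ z in cylinderCompl N R γ, ENNReal.ofReal (h z.1
          * (u z + R ^ (-M)) ^ q * logCutoff R γ z ^ s * (u z + R ^ (-M)) ^ (-(1 / log R))) ∂muS a
        + ENNReal.ofReal (lam ^ (-(1 / (q - 1))) * (exp M * (2 * s * γ⁻¹) ^ (q / (q - 1))
          * (γ * (C * 2 ^ σ * 3 ^ (1 / (q - 1)))))) := by
  have hR0 : 0 < R := by linarith
  have hR1 : 1 < R := by linarith
  have hlog := one_le_log_of_three_le hR
  have hql : 0 < q - 1 := by linarith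
  have hac := muS_absolutelyContinuous (N := N) ha
  have hexp : 1 / (q - 1) + 1 = q / (q - 1) := by field_simp; ring
  set A : Set (Euc N × ℝ) := {z | R ^ γ ≤ z.2 ∧ z.2 ≤ R ^ (2 * γ) ∧ ‖z.1‖ ^ γ ≤ z.2} with hA
  have hAm : MeasurableSet A := by
    simp only [hA, ofPred_and]
    exact (measurableSet_le (by fun_prop) (by fun_prop)).inter
      ((measurableSet_le (by fun_prop) (by fun_prop)).inter
        (measurableSet_le (by fun_prop) (by fun_prop)))
  set c : ℝ := lam ^ (-(1 / (q - 1))) * (exp M * (2 * s * γ⁻¹) ^ (q / (q - 1)))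
    * log R ^ (-(q / (q - 1))) with hc
  have hc0 : 0 ≤ c := by positivity
  set Z : Euc N × ℝ → ℝ≥0∞ := fun z => ENNReal.ofReal (h z.1 * (u z + R ^ (-M)) ^ q
    * logCutoff R γ z ^ s * (u z + R ^ (-M)) ^ (-(1 / log R))) with hZ
  set J : Euc N × ℝ → ℝ≥0∞ := fun z => ENNReal.ofReal (z.2 ^ (-(1 / (q - 1) + 1)))
    * ENNReal.ofReal (h z.1 ^ (-(1 / (q - 1)))) with hJ
  have hJm : Measurable J := by fun_prop
  calc _ ≤ ∫⁻ z, A.indicator (fun z => ENNReal.ofReal lam * Z z + ENNReal.ofReal c * J z) z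
          ∂muS a := by
        refine lintegral_mono_ae ?_
        filter_upwards [hac.ae_le (ae_restrict_of_ae (ae_differentiableAt_logCutoff γ hR1)),
          hac.ae_le (ae_restrict_mem (isOpen_Sset N).measurableSet), hpos] with z hd hz hH
        have hu := hu0 z hz
        have hδ : 0 < R ^ (-M) := by positivity
        have hφ := logCutoff_nonneg (R := R) (γ := γ) z
        have hφ1 := logCutoff_le_one (γ := γ) hR1 z
        rcases le_or_gt 0 (timeDeriv (logCutoff R γ) z) with hv | hv
        · rw [max_eq_left (by linarith)]
          simp
        · obtain ⟨h1, h2, h3, h4⟩ := logCutoff_time_deriv hR1 hγ hd.hasFDerivAt_pairCLM hz hv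
          have ht0 : 0 < z.2 := hz
          rw [indicator_of_mem (show z ∈ A from ⟨h1, h2, h3⟩)]
          simp only [hZ, hJ]
          rw [← ENNReal.ofReal_mul hlam.le, ← ENNReal.ofReal_mul (by positivity),
            ← ENNReal.ofReal_mul hc0, ← ENNReal.ofReal_add (by positivity) (by positivity)]
          refine ENNReal.ofReal_le_ofReal ?_
          have hcd : 2 * s * max 0 (-timeDeriv (logCutoff R γ) z)
              ≤ 2 * s * γ⁻¹ * (log R)⁻¹ * z.2⁻¹ := by
            rw [max_eq_right (by linarith)]
            calc _ ≤ 2 * s * (1 / (γ * z.2 * log R)) := by gcongr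
              _ = _ := by field_simp
          have key := cutoff_mul_rpow_mul_le one_pos hq (by positivity) hcd hφ hφ1 hH
            (by positivity : 0 ≤ u z + R ^ (-M)) hlam s.cast_nonneg hs (by positivity)
            (rpow_neg_one_div_log_le (M := M) hR (le_add_of_nonneg_left hu))
          refine le_trans (le_of_eq ?_) (key.trans_eq ?_)
          · rw [Real.rpow_one, ← Nat.cast_pred hs0, Real.rpow_natCast]
            ring
          · rw [Real.rpow_natCast, hc, Real.mul_rpow (by positivity) (by positivity),
              Real.mul_rpow (by positivity) (by positivity), Real.inv_rpow (by positivity),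
              Real.inv_rpow (by positivity), ← Real.rpow_neg (by positivity),
              ← Real.rpow_neg (by positivity), hexp]
            ring
    _ = ENNReal.ofReal lam * ∫⁻ z in A, Z z ∂muS a + ENNReal.ofReal c * ∫⁻ z in A, J z ∂muS a := by
        rw [lintegral_indicator hAm, lintegral_add_right _ (hJm.const_mul _),
          lintegral_const_mul' _ _ ENNReal.ofReal_ne_top,
          lintegral_const_mul' _ _ ENNReal.ofReal_ne_top]
    _ ≤ ENNReal.ofReal lam * ∫⁻ z in cylinderCompl N R γ, Z z ∂muS a + ENNReal.ofReal c
          * ENNReal.ofReal (γ * (C * 2 ^ σ * 3 ^ (1 / (q - 1))) * log R ^ (1 / (q - 1) + 1)) := by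
        gcongr
        · exact fun z hz => Or.inr hz.1
        · exact lintegral_prod_time_tail_le (by fun_prop) (by positivity) hC hγ hσγ hint hR hR₁
    _ = _ := by
        rw [← ENNReal.ofReal_mul hc0]
        congr 2
        have h1 : log R ^ (-(q / (q - 1))) * log R ^ (q / (q - 1)) = 1 := by
          rw [← Real.rpow_add (by linarith), neg_add_cancel, Real.rpow_zero]
        rw [hc, hexp]
        linear_combination (lam ^ (-(1 / (q - 1))) * (exp M * (2 * s * γ⁻¹) ^ (q / (q - 1)))
          * (γ * (C * 2 ^ σ * 3 ^ (1 / (q - 1))))) * h1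

/-- Replacing `u + R ^ (-M)` by `u` costs a constant factor and a term supported where the cutoff
is. -/
lemma lintegral_regularized_le {N : ℕ} {a : Euc N → ℝ} (ha : Measurable a)
    {u : Euc N × ℝ → ℝ} (hu0 : ∀ z ∈ Sset N, 0 ≤ u z) {h : Euc N → ℝ} (hmeas : Measurable h)
    (hpos : ∀ᵐ z ∂muS a, 0 < h z.1) {q M γ R : ℝ} {s : ℕ} (hq : 1 < q) (hM : 0 ≤ M) (hγ : 0 < γ)
    (hs : s ≠ 0) (hR : 3 ≤ R) (T : Set (Euc N × ℝ)) :
    ∫⁻ z in T, ENNReal.ofReal (h z.1 * (u z + R ^ (-M)) ^ q * logCutoff R γ z ^ s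
        * (u z + R ^ (-M)) ^ (-(1 / log R))) ∂muS a
      ≤ ENNReal.ofReal (2 ^ q) * (∫⁻ z in T, ENNReal.ofReal (logCutoff R γ z ^ s
          * (u z + R ^ (-M)) ^ (-(1 / log R)) * u z ^ q * h z.1) ∂muS a
        + ∫⁻ z in closedBall (0 : Euc N) (R ^ 2) ×ˢ Icc R⁻¹ (R ^ (2 * γ)),
          ENNReal.ofReal (exp M * R ^ (-M)) * ENNReal.ofReal (h z.1) ∂muS a) := by
  have hR0 : 0 < R := by linarith
  have hR1 : 1 < R := by linarith
  have hac := muS_absolutelyContinuous (N := N) ha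
  set Q := closedBall (0 : Euc N) (R ^ 2) ×ˢ Icc R⁻¹ (R ^ (2 * γ)) with hQ
  have hQm : MeasurableSet Q := measurableSet_closedBall.prod measurableSet_Icc
  set J : Euc N × ℝ → ℝ≥0∞ := Q.indicator fun z =>
    ENNReal.ofReal (exp M * R ^ (-M)) * ENNReal.ofReal (h z.1) with hJ
  have hJm : Measurable J := Measurable.indicator (by fun_prop) hQm
  calc _ ≤ ∫⁻ z in T, ENNReal.ofReal (2 ^ q) * (ENNReal.ofReal (logCutoff R γ z ^ s
          * (u z + R ^ (-M)) ^ (-(1 / log R)) * u z ^ q * h z.1) + J z) ∂muS a := by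
        refine lintegral_mono_ae (ae_restrict_of_ae ?_)
        filter_upwards [hac.ae_le (ae_restrict_mem (isOpen_Sset N).measurableSet), hpos]
          with z hz hH
        have hu := hu0 z hz
        have hδ : 0 < R ^ (-M) := by positivity
        have hφ := logCutoff_nonneg (R := R) (γ := γ) z
        have hφ1 := logCutoff_le_one (γ := γ) hR1 z
        by_cases hzQ : z ∈ Q
        · simp only [hJ, indicator_of_mem hzQ]
          rw [← ENNReal.ofReal_mul (by positivity), ← ENNReal.ofReal_add (by positivity)
            (by positivity), ← ENNReal.ofReal_mul (by positivity)]
          refine ENNReal.ofReal_le_ofReal ?_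
          have hy := rpow_neg_one_div_log_le (M := M) hR (le_add_of_nonneg_left hu)
          have hy0 : 0 ≤ (u z + R ^ (-M)) ^ (-(1 / log R)) := by positivity
          have h1 : (u z + R ^ (-M)) ^ q ≤ 2 ^ q * (u z ^ q + R ^ (-M)) := by
            have hδq : (R ^ (-M)) ^ q ≤ R ^ (-M) :=
              Real.rpow_le_self_of_le_one hδ.le
                (Real.rpow_le_one_of_one_le_of_nonpos hR1.le (by linarith)) hq.le
            have hq0 : 0 ≤ q := by linarith
            rcases le_total (u z) (R ^ (-M)) with hle | hle
            · calc _ ≤ (2 * R ^ (-M)) ^ q := by gcongr; linarith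
                _ = 2 ^ q * (R ^ (-M)) ^ q := Real.mul_rpow zero_le_two hδ.le
                _ ≤ _ := by
                  gcongr
                  exact hδq.trans (le_add_of_nonneg_left (by positivity))
            · calc _ ≤ (2 * u z) ^ q := by gcongr; linarith
                _ = 2 ^ q * u z ^ q := Real.mul_rpow zero_le_two hu
                _ ≤ _ := by
                  gcongr
                  exact le_add_of_nonneg_right hδ.le
          have hφs : logCutoff R γ z ^ s ≤ 1 := pow_le_one₀ hφ hφ1
          calc _ ≤ h z.1 * (2 ^ q * (u z ^ q + R ^ (-M))) * logCutoff R γ z ^ s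
                * (u z + R ^ (-M)) ^ (-(1 / log R)) := by gcongr
            _ = 2 ^ q * (logCutoff R γ z ^ s * (u z + R ^ (-M)) ^ (-(1 / log R)) * u z ^ q * h z.1
                + logCutoff R γ z ^ s * (u z + R ^ (-M)) ^ (-(1 / log R)) * R ^ (-M) * h z.1) := by
              ring
            _ ≤ 2 ^ q * (logCutoff R γ z ^ s * (u z + R ^ (-M)) ^ (-(1 / log R)) * u z ^ q * h z.1
                + 1 * exp M * R ^ (-M) * h z.1) := by gcongr
            _ = _ := by ring
        · have : logCutoff R γ z = 0 := by
            by_contra hne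
            exact hzQ (logCutoff_support_subset hR1 hγ (subset_tsupport _ hne))
          simp [this, hs]
    _ = ENNReal.ofReal (2 ^ q) * (∫⁻ z in T, ENNReal.ofReal (logCutoff R γ z ^ s
          * (u z + R ^ (-M)) ^ (-(1 / log R)) * u z ^ q * h z.1) ∂muS a
          + ∫⁻ z in T, J z ∂muS a) := by
        rw [lintegral_const_mul' _ _ ENNReal.ofReal_ne_top, lintegral_add_right _ hJm]
    _ ≤ _ := by
        refine mul_le_mul_right (add_le_add le_rfl ((setLIntegral_le_lintegral _ _).trans_eq ?_)) _
        rw [hJ, lintegral_indicator hQm]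

lemma lintegral_rect_const_mul_le {N : ℕ} {a : Euc N → ℝ} {h : Euc N → ℝ} {C α b σ γ M R₁ R : ℝ}
    (hC : 0 < C) (hα : 0 ≤ α) (hb : 0 ≤ b)
    (hh : ∀ᵐ x ∂muA a, 0 < h x ∧ h x ≤ C * (1 + ‖x‖) ^ α)
    (hint : ∀ r, R₁ ≤ r → ∫⁻ x in ball (0 : Euc N) r, ENNReal.ofReal (h x ^ (-b)) ∂muA a
      ≤ ENNReal.ofReal (C * r ^ σ * log r ^ b))
    (hM : M = 3 * α * (1 + b) + 3 * σ + b + 2 * γ + 1) (hR : 3 ≤ R) (hR₁ : R₁ ≤ R) :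
    ∫⁻ z in closedBall (0 : Euc N) (R ^ 2) ×ˢ Icc R⁻¹ (R ^ (2 * γ)),
        ENNReal.ofReal (exp M * R ^ (-M)) * ENNReal.ofReal (h z.1) ∂muS a
      ≤ ENNReal.ofReal (exp M * (C ^ (1 + b) * C * 3 ^ b) * R⁻¹) := by
  have hR0 : 0 < R := by linarith
  rw [lintegral_const_mul' _ _ ENNReal.ofReal_ne_top]
  calc _ ≤ ENNReal.ofReal (exp M * R ^ (-M)) * (ENNReal.ofReal (C ^ (1 + b) * C * 3 ^ b
          * R ^ (3 * α * (1 + b) + 3 * σ + b)) * ENNReal.ofReal (R ^ (2 * γ))) := by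
        gcongr
        refine (lintegral_prod_fst_rect (F := fun x => ENNReal.ofReal (h x))
          (by positivity)).trans ?_
        gcongr
        exact lintegral_closedBall_le_of_growth hC hα hb hh hint hR hR₁
    _ = _ := by
        rw [← ENNReal.ofReal_mul (by positivity), ← ENNReal.ofReal_mul (by positivity)]
        congr 1
        have : R ^ (-M) * (R ^ (3 * α * (1 + b) + 3 * σ + b) * R ^ (2 * γ)) = R⁻¹ := by
          rw [← Real.rpow_add hR0, ← Real.rpow_add hR0, ← Real.rpow_neg_one]
          congr 1
          rw [hM]; ring
        linear_combination exp M * (C ^ (1 + b) * C * 3 ^ b) * this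

/-- The absorbing estimate: up to lower order terms, the integral of the regularized reaction term
is controlled by a small multiple of its integral outside a large cylinder. -/
lemma IsWeakSol.exists_absorbing_estimate {N : ℕ} {p m q K : ℝ} {V : Euc N × ℝ → ℝ} {f : ℝ → ℝ}
    {a : Euc N → ℝ} {u : Euc N × ℝ → ℝ} {gu : Euc N × ℝ → Euc N} {ut : Euc N × ℝ → ℝ}
    (hu : IsWeakSol N p m q V f a u gu ut) (hp : 1 < p) (hm : 1 ≤ m) (hK : 0 ≤ K)
    (hf : ∀ s : ℝ, 0 ≤ s → 0 ≤ f s ∧ f s ≤ K) (haLip : LocallyLipschitz a) (ha0 : ∀ x, 0 ≤ a x)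
    (hV : ∀ᵐ z ∂((volume : Measure (Euc N × ℝ)).restrict (Sset N)), 0 < V z)
    {h : Euc N → ℝ} (hmeas : Measurable h)
    (hVlow : ∀ᵐ z ∂((volume : Measure (Euc N × ℝ)).restrict (Sset N)), h z.1 ≤ V z)
    {C α l σ₁ σ₂ γ M R₁ : ℝ} {s : ℕ} (hC : 0 < C) (hα : 0 ≤ α)
    (hh : ∀ᵐ x ∂muA a, 0 < h x ∧ h x ≤ C * (1 + ‖x‖) ^ α) (hpos : ∀ᵐ z ∂muS a, 0 < h z.1)
    (hl : l = p + m - 2) (hlq : l < q) (hq : 1 < q) (hσ₁0 : 0 ≤ σ₁) (hσ₂ : 0 ≤ σ₂) (hγ : 0 < γ)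
    (hσγ : σ₂ + γ = p * q / (q - l)) (hσ₁ : σ₁ ≤ 1 / (q - 1) * γ)
    (hint₁ : ∀ r, R₁ ≤ r → ∫⁻ x in ball (0 : Euc N) r,
      ENNReal.ofReal (h x ^ (-(1 / (q - 1)))) ∂muA a
        ≤ ENNReal.ofReal (C * r ^ σ₁ * log r ^ (1 / (q - 1))))
    (hint₂ : ∀ r, R₁ ≤ r → ∫⁻ x in ball (0 : Euc N) r,
      ENNReal.ofReal (h x ^ (-(l / (q - l)))) ∂muA a
        ≤ ENNReal.ofReal (C * r ^ σ₂ * log r ^ (l / (q - l))))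
    (hM : M = 3 * α * (1 + 1 / (q - 1)) + 3 * σ₁ + 1 / (q - 1) + 2 * γ + 1)
    (hs : 2 ≤ s) (hsl : s * (l / q) ≤ s - p) (hs1 : s * (1 / q) ≤ s - 1) :
    ∃ c₁ c₂ c₃ : ℝ, ∀ R, 9 ≤ R → R₁ ≤ R → ∀ lam : ℝ, 0 < lam →
      ∫⁻ z, ENNReal.ofReal (logCutoff R γ z ^ s * (u z + R ^ (-M)) ^ (-(1 / log R))
          * u z ^ q * h z.1) ∂muS a
        ≤ ENNReal.ofReal lam * (∫⁻ z in cylinderCompl N R γ, ENNReal.ofReal (logCutoff R γ z ^ s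
            * (u z + R ^ (-M)) ^ (-(1 / log R)) * u z ^ q * h z.1) ∂muS a
            + ENNReal.ofReal (c₁ * R⁻¹))
          + (ENNReal.ofReal ((lam / (2 * 2 ^ q)) ^ (-(l / (q - l))) * c₂)
            + ENNReal.ofReal ((lam / (2 * 2 ^ q)) ^ (-(1 / (q - 1))) * c₃)) := by
  have ha := haLip.continuous.measurable
  have hac := muS_absolutelyContinuous (N := N) ha
  have hb : 0 ≤ 1 / (q - 1) := div_nonneg zero_le_one (by linarith)
  have hM0 : 0 ≤ M := by rw [hM]; positivity
  refine ⟨exp M * (C ^ (1 + 1 / (q - 1)) * C * 3 ^ (1 / (q - 1))),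
    exp M * (K * s ^ p * 2 ^ p) ^ (q / (q - l)) * (3 * (C * 2 ^ σ₂ * 3 ^ (l / (q - l)))),
    exp M * (2 * s * γ⁻¹) ^ (q / (q - 1)) * (γ * (C * 2 ^ σ₁ * 3 ^ (1 / (q - 1)))),
    fun R hR9 hR₁ lam hlam => ?_⟩
  have hR : 3 ≤ R := by linarith
  have hR0 : 0 < R := by linarith
  have hR1 : 1 < R := by linarith
  have hlog : 2 ≤ log R := by
    have h9 : log 9 = 2 * log 3 := by
      rw [show (9 : ℝ) = 3 ^ 2 by norm_num, Real.log_pow]; norm_num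
    have := Real.log_le_log (by norm_num) hR9
    linarith [one_le_log_of_three_le le_rfl]
  have hδ : 0 < R ^ (-M) := by positivity
  have hlam' : 0 < lam / (2 * 2 ^ q) := by positivity
  have hcut := hu.lintegral_cutoff_le hp hm hf haLip ha0 hV hR1 hγ
    (σ := 1 / log R) (δ := R ^ (-M)) (by positivity)
    (by rw [div_le_div_iff₀ (by linarith) two_pos]; linarith) hδ hs
  rw [← hl] at hcut
  have hgrad := lintegral_gradient_term_le (M := M) ha hu.nonneg hmeas hpos hp
    (by rw [hl]; linarith) hlq hK hC.le hσ₂ hγ hσγ hsl hint₂ hR hR₁ hlam'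
  have htime := lintegral_time_term_le (M := M) ha hu.nonneg hmeas hpos hq hC.le hγ hσ₁
    (by omega) hs1 hint₁ hR hR₁ hlam'
  have hreg := lintegral_regularized_le ha hu.nonneg hmeas hpos hq hM0 hγ (by omega : s ≠ 0) hR
    (cylinderCompl N R γ)
  have hrect := lintegral_rect_const_mul_le hC hα hb hh hint₁ hM hR hR₁
  have hlow : ∫⁻ z, ENNReal.ofReal (logCutoff R γ z ^ s * (u z + R ^ (-M)) ^ (-(1 / log R))
          * u z ^ q * h z.1) ∂muS a
      ≤ ∫⁻ z, ENNReal.ofReal (logCutoff R γ z ^ s * (u z + R ^ (-M)) ^ (-(1 / log R))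
          * u z ^ q * V z) ∂muS a := by
    refine lintegral_mono_ae ?_
    filter_upwards [hac.ae_le (ae_restrict_mem (isOpen_Sset N).measurableSet),
      hac.ae_le hVlow] with z hz hVz
    have := hu.nonneg z hz
    have hφ := logCutoff_nonneg (R := R) (γ := γ) z
    gcongr
  refine hlow.trans (hcut.trans ((add_le_add hgrad htime).trans ?_))
  rw [add_add_add_comm, ← two_mul]
  refine add_le_add ?_ le_rfl
  calc _ ≤ 2 * (ENNReal.ofReal (lam / (2 * 2 ^ q)) * (ENNReal.ofReal (2 ^ q)
        * (∫⁻ z in cylinderCompl N R γ, ENNReal.ofReal (logCutoff R γ z ^ s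
            * (u z + R ^ (-M)) ^ (-(1 / log R)) * u z ^ q * h z.1) ∂muS a
          + ENNReal.ofReal (exp M * (C ^ (1 + 1 / (q - 1)) * C * 3 ^ (1 / (q - 1))) * R⁻¹)))) := by
        refine mul_le_mul_right (mul_le_mul_right (hreg.trans ?_) _) _
        exact mul_le_mul_right (add_le_add le_rfl hrect) _
    _ = _ := by
        have h2 : 2 * ENNReal.ofReal (lam / (2 * 2 ^ q)) * ENNReal.ofReal (2 ^ q)
            = ENNReal.ofReal lam := by
          rw [← ENNReal.ofReal_ofNat 2, ← ENNReal.ofReal_mul zero_le_two,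
            ← ENNReal.ofReal_mul (by positivity)]
          congr 1
          field_simp
        rw [← mul_assoc, ← mul_assoc, h2]

/-- The regularized reaction terms converge pointwise as the cutoff radius tends to infinity. -/
lemma tendsto_cutoff_mul_rpow {N : ℕ} {γ M q c y : ℝ} (s : ℕ) {z : Euc N × ℝ} (hz : 0 < z.2)
    (hγ : 0 < γ) (hM : 0 < M) (hq : 0 < q) (hc : 0 ≤ c) :
    Filter.Tendsto (fun n : ℕ => logCutoff (n : ℝ) γ z ^ s * (c + (n : ℝ) ^ (-M)) ^ (-(1 / log n))
      * c ^ q * y) Filter.atTop (nhds (c ^ q * y)) := by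
  rcases hc.eq_or_lt with rfl | hc
  · simp [Real.zero_rpow hq.ne']
  have hn := tendsto_natCast_atTop_atTop (R := ℝ)
  have hφ : ∀ᶠ n : ℕ in Filter.atTop, logCutoff (n : ℝ) γ z ^ s = 1 := by
    filter_upwards [hn.eventually_ge_atTop ‖z.1‖, hn.eventually_gt_atTop 1,
      ((tendsto_rpow_atTop hγ).comp hn).eventually_ge_atTop z.2,
      (hn.atTop_mul_const hz).eventually_ge_atTop 2] with n h1 h2 h3 h4
    rw [logCutoff_eq_one h2 hγ h1 h3 h4, one_pow]
  have hw : Filter.Tendsto (fun n : ℕ => (c + (n : ℝ) ^ (-M)) ^ (-(1 / log n))) Filter.atTop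
      (nhds 1) := by
    have h1 : Filter.Tendsto (fun n : ℕ => c + (n : ℝ) ^ (-M)) Filter.atTop (nhds c) := by
      simpa using tendsto_const_nhds.add ((tendsto_rpow_neg_atTop hM).comp hn)
    have h2 : Filter.Tendsto (fun n : ℕ => -(1 / log n)) Filter.atTop (nhds 0) := by
      simpa using ((Real.tendsto_log_atTop.comp hn).inv_tendsto_atTop).neg
    simpa using h1.rpow h2 (Or.inl hc.ne')
  have hlim := ((tendsto_const_nhds (x := (1 : ℝ))).congr' (hφ.mono fun n hn => hn.symm)).mul hw
  simpa using (hlim.mul_const (c ^ q)).mul_const y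

lemma tendsto_ofReal_div_rpow_neg_mul {κ d : ℝ} (c : ℝ) (hκ : 0 < κ) (hd : 0 < d) :
    Filter.Tendsto (fun lam : ℝ => ENNReal.ofReal ((lam / d) ^ (-κ) * c)) Filter.atTop
      (nhds 0) := by
  have h := ((tendsto_rpow_neg_atTop hκ).comp
    (Filter.tendsto_id.atTop_div_const hd)).mul_const c
  simpa using ENNReal.tendsto_ofReal h

lemma eventually_notMem_cylinderCompl {N : ℕ} {γ : ℝ} (hγ : 0 < γ) (z : Euc N × ℝ) :
    ∀ᶠ n : ℕ in Filter.atTop, z ∉ cylinderCompl N (n : ℝ) γ := by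
  have hn := tendsto_natCast_atTop_atTop (R := ℝ)
  filter_upwards [hn.eventually_gt_atTop ‖z.1‖,
    ((tendsto_rpow_atTop hγ).comp hn).eventually_gt_atTop z.2] with n h1 h2
  rintro (h | h)
  · exact h1.not_ge h
  · exact h2.not_ge h

lemma IsWeakSol.aemeasurable {N : ℕ} {p m q : ℝ} {V : Euc N × ℝ → ℝ} {f : ℝ → ℝ}
    {a : Euc N → ℝ} {u : Euc N × ℝ → ℝ} {gu : Euc N × ℝ → Euc N} {ut : Euc N × ℝ → ℝ}
    (hu : IsWeakSol N p m q V f a u gu ut) (ha : Measurable a) : AEMeasurable u (muS a) :=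
  (hu.locLip.continuousOn.aemeasurable (isOpen_Sset N).measurableSet).mono_ac
    (muS_absolutelyContinuous ha)

/-- The weighted integral of `u ^ q * h` vanishes for every weak solution. -/
lemma IsWeakSol.lintegral_reaction_eq_zero {N : ℕ} {p m q K : ℝ} {V : Euc N × ℝ → ℝ} {f : ℝ → ℝ}
    {a : Euc N → ℝ} {u : Euc N × ℝ → ℝ} {gu : Euc N × ℝ → Euc N} {ut : Euc N × ℝ → ℝ}
    (hu : IsWeakSol N p m q V f a u gu ut) (hp : 1 < p) (hm : 1 ≤ m) (hK : 0 ≤ K)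
    (hf : ∀ s : ℝ, 0 ≤ s → 0 ≤ f s ∧ f s ≤ K) (haLip : LocallyLipschitz a) (ha0 : ∀ x, 0 ≤ a x)
    (hV : ∀ᵐ z ∂((volume : Measure (Euc N × ℝ)).restrict (Sset N)), 0 < V z)
    {h : Euc N → ℝ} (hmeas : Measurable h)
    (hVlow : ∀ᵐ z ∂((volume : Measure (Euc N × ℝ)).restrict (Sset N)), h z.1 ≤ V z)
    {C α l σ₁ σ₂ γ R₁ : ℝ} (hC : 0 < C) (hα : 0 ≤ α)
    (hh : ∀ᵐ x ∂muA a, 0 < h x ∧ h x ≤ C * (1 + ‖x‖) ^ α) (hpos : ∀ᵐ z ∂muS a, 0 < h z.1)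
    (hl : l = p + m - 2) (hlq : l < q) (hq : 1 < q) (hσ₁0 : 0 ≤ σ₁) (hσ₂ : 0 ≤ σ₂) (hγ : 0 < γ)
    (hσγ : σ₂ + γ = p * q / (q - l)) (hσ₁ : σ₁ ≤ 1 / (q - 1) * γ)
    (hint₁ : ∀ r, R₁ ≤ r → ∫⁻ x in ball (0 : Euc N) r,
      ENNReal.ofReal (h x ^ (-(1 / (q - 1)))) ∂muA a
        ≤ ENNReal.ofReal (C * r ^ σ₁ * log r ^ (1 / (q - 1))))
    (hint₂ : ∀ r, R₁ ≤ r → ∫⁻ x in ball (0 : Euc N) r,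
      ENNReal.ofReal (h x ^ (-(l / (q - l)))) ∂muA a
        ≤ ENNReal.ofReal (C * r ^ σ₂ * log r ^ (l / (q - l)))) :
    ∫⁻ z, ENNReal.ofReal (u z ^ q * h z.1) ∂muS a = 0 := by
  have ha := haLip.continuous.measurable
  have hac := muS_absolutelyContinuous (N := N) ha
  have hum := hu.aemeasurable ha
  have hql : 0 < q - l := by linarith
  have hq1 : 0 < q - 1 := by linarith
  have hl0 : 0 < l := by rw [hl]; linarith
  have hn := tendsto_natCast_atTop_atTop (R := ℝ)
  obtain ⟨s, hs2, hsl, hs1⟩ : ∃ s : ℕ, 2 ≤ s ∧ s * (l / q) ≤ s - p ∧ s * (1 / q) ≤ s - 1 := by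
    obtain ⟨s, h1, h2, h3⟩ := ((Filter.eventually_ge_atTop 2).and
      ((hn.eventually_ge_atTop (p * q / (q - l))).and
        (hn.eventually_ge_atTop (q / (q - 1))))).exists
    rw [div_le_iff₀ hql] at h2
    rw [div_le_iff₀ hq1] at h3
    refine ⟨s, h1, ?_, ?_⟩
    · rw [← mul_div_assoc, div_le_iff₀ (by linarith)]
      linarith
    · rw [← mul_div_assoc, div_le_iff₀ (by linarith)]
      linarith
  obtain ⟨M, hM⟩ : ∃ M : ℝ, M = 3 * α * (1 + 1 / (q - 1)) + 3 * σ₁ + 1 / (q - 1) + 2 * γ + 1 :=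
    ⟨_, rfl⟩
  have hM0 : 0 < M := by rw [hM]; positivity
  obtain ⟨c₁, c₂, c₃, hmain⟩ := hu.exists_absorbing_estimate hp hm hK hf haLip ha0 hV hmeas hVlow
    hC hα hh hpos hl hlq hq hσ₁0 hσ₂ hγ hσγ hσ₁ hint₁ hint₂ hM hs2 hsl hs1
  have hnonneg : ∀ᵐ z ∂muS a, z ∈ Sset N ∧ 0 ≤ u z ∧ 0 < h z.1 ∧ h z.1 ≤ V z := by
    filter_upwards [hac.ae_le (ae_restrict_mem (isOpen_Sset N).measurableSet), hpos,
      hac.ae_le hVlow] with z hz hH hVz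
    exact ⟨hz, hu.nonneg z hz, hH, hVz⟩
  have hdom : ∀ᶠ n : ℕ in Filter.atTop, ∀ᵐ z ∂muS a,
      ENNReal.ofReal (logCutoff (n : ℝ) γ z ^ s * (u z + (n : ℝ) ^ (-M)) ^ (-(1 / log n))
        * u z ^ q * h z.1) ≤ ENNReal.ofReal (exp M) * ENNReal.ofReal (u z ^ q * h z.1) := by
    filter_upwards [hn.eventually_ge_atTop 3] with n hn3
    filter_upwards [hnonneg] with z ⟨hz, huz, hH, hVz⟩
    rw [← ENNReal.ofReal_mul (by positivity), ← mul_assoc]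
    have hy := rpow_neg_one_div_log_le (M := M) hn3 (le_add_of_nonneg_left huz)
    have hφ := pow_le_one₀ (n := s) (logCutoff_nonneg (R := n) (γ := γ) z)
      (logCutoff_le_one (by linarith) z)
    have hφ0 := logCutoff_nonneg (R := n) (γ := γ) z
    gcongr
    exact (mul_le_mul hφ hy (by positivity) zero_le_one).trans_eq (one_mul _)
  refine lintegral_eq_zero_of_absorbing_estimate
    (Φ := fun n z => ENNReal.ofReal (logCutoff (n : ℝ) γ z ^ s
      * (u z + (n : ℝ) ^ (-M)) ^ (-(1 / log n)) * u z ^ q * h z.1))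
    (T := fun n => cylinderCompl N (n : ℝ) γ) (ε := fun n => ENNReal.ofReal (c₁ * (n : ℝ)⁻¹))
    (G := fun lam => ENNReal.ofReal ((lam / (2 * 2 ^ q)) ^ (-(l / (q - l))) * c₂)
      + ENNReal.ofReal ((lam / (2 * 2 ^ q)) ^ (-(1 / (q - 1))) * c₃))
    (M := ENNReal.ofReal (exp M)) ?_ (fun n => ?_) (fun n => measurableSet_cylinderCompl _ _ _)
    ?_ ENNReal.ofReal_ne_top hdom ?_ (eventually_notMem_cylinderCompl hγ) ?_
    (fun lam _ => ENNReal.add_ne_top.2 ⟨ENNReal.ofReal_ne_top, ENNReal.ofReal_ne_top⟩) ?_ ?_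
  · fun_prop
  · have hφ : Measurable (logCutoff (N := N) (n : ℝ) γ) := by
      unfold logCutoff logRadius
      fun_prop
    fun_prop
  · filter_upwards [hnonneg] with z ⟨hz, huz, hH, hVz⟩
    exact ENNReal.tendsto_ofReal (tendsto_cutoff_mul_rpow s hz hγ hM0 (by linarith) huz)
  · filter_upwards [hdom, hn.eventually_gt_atTop 1] with n hdn hn1
    have hn0 : (0 : ℝ) < n := by linarith
    set Q := closedBall (0 : Euc N) ((n : ℝ) ^ 2) ×ˢ Icc (n : ℝ)⁻¹ ((n : ℝ) ^ (2 * γ)) with hQ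
    have hQm : MeasurableSet Q := measurableSet_closedBall.prod measurableSet_Icc
    have hQc : IsCompact Q := (isCompact_closedBall _ _).prod isCompact_Icc
    have hQS : Q ⊆ Sset N := fun z hz => (inv_pos.2 hn0).trans_le hz.2.1
    have hint := (hu.int_uqV.integrableOn_compact_subset hQS hQc).lintegral_lt_top
    refine ne_top_of_le_ne_top (ENNReal.mul_ne_top ENNReal.ofReal_ne_top hint.ne) (b :=
      ENNReal.ofReal (exp M) * ∫⁻ z in Q, ENNReal.ofReal (u z ^ q * V z) ∂muS a) ?_
    rw [← lintegral_const_mul' _ _ ENNReal.ofReal_ne_top, ← lintegral_indicator hQm]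
    refine lintegral_mono_ae ?_
    filter_upwards [hdn, hnonneg] with z hdz ⟨hz, huz, hH, hVz⟩
    by_cases hzQ : z ∈ Q
    · rw [indicator_of_mem hzQ]
      refine hdz.trans ?_
      gcongr
    · have : logCutoff (n : ℝ) γ z = 0 := by
        by_contra hne
        exact hzQ (logCutoff_support_subset hn1 hγ (subset_tsupport _ hne))
      simp [this, show s ≠ 0 by omega]
  · simpa using ENNReal.tendsto_ofReal (hn.inv_tendsto_atTop.const_mul c₁)
  · simpa using (tendsto_ofReal_div_rpow_neg_mul c₂ (div_pos hl0 hql) (by positivity)).add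
      (tendsto_ofReal_div_rpow_neg_mul c₃ (div_pos one_pos hq1) (by positivity))
  · filter_upwards [hn.eventually_ge_atTop 9, hn.eventually_ge_atTop R₁] with n h9 hR₁
    exact hmain n h9 hR₁

/-- Corollary 1.11 (Euclidean specialization): time-independent potential
with two-sided bounds and critical logarithmic exponents. -/
theorem corollary_time_independent_potential_critical
    (N : ℕ) (hN : 1 ≤ N) (p m q K : ℝ)
    (hp : 1 < p) (hm : 1 ≤ m) (hq : max (p + m - 2) 1 < q) (hK : 0 < K)
    (V : Euc N × ℝ → ℝ) (f : ℝ → ℝ) (a : Euc N → ℝ)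
    (hVmeas : Measurable V)
    (hVpos : ∀ᵐ z ∂ ((volume : Measure (Euc N × ℝ)).restrict (Sset N)), 0 < V z)
    (hVloc : LocallyIntegrableOn V (Sset N) (muS a))
    (hf : ∀ s : ℝ, 0 ≤ s → 0 ≤ f s ∧ f s ≤ K)
    (haLip : LocallyLipschitz a)
    (haPos : ∀ᵐ x ∂ (volume : Measure (Euc N)), 0 < a x)
    (h : Euc N → ℝ) (hhmeas : Measurable h)
    (α σ1 σ2 C : ℝ)
    (hα : 0 ≤ α) (hσ1 : 0 ≤ σ1) (hσ2 : 0 ≤ σ2) (hC : 0 < C)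
    (hVlow : ∀ᵐ z ∂ ((volume : Measure (Euc N × ℝ)).restrict (Sset N)), h z.1 ≤ V z)
    (hh : ∀ᵐ x ∂ (volume : Measure (Euc N)),
      C⁻¹ * (1 + ‖x‖) ^ (-α) ≤ h x ∧ h x ≤ C * (1 + ‖x‖) ^ α)
    (hint : ∃ R1 : ℝ, 1 < R1 ∧ ∀ R, R1 ≤ R →
      (∫ x in Metric.ball (0 : Euc N) R, h x ^ (-(1 / (q - 1))) ∂ muA a)
        ≤ C * R ^ σ1 * Real.log R ^ (1 / (q - 1)) ∧
      (∫ x in Metric.ball (0 : Euc N) R,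
          h x ^ (-((p + m - 2) / (q - p - m + 2))) ∂ muA a)
        ≤ C * R ^ σ2 * Real.log R ^ ((p + m - 2) / (q - p - m + 2)))
    (hcond1 : σ2 < p * q / (q - p - m + 2))
    (hcond2 : σ1 ≤ (1 / (q - 1)) * (p * q / (q - p - m + 2) - σ2))
    (u : Euc N × ℝ → ℝ) (gu : Euc N × ℝ → Euc N) (ut : Euc N × ℝ → ℝ)
    (hu : IsWeakSol N p m q V f a u gu ut) :
    ∀ᵐ z ∂ ((volume : Measure (Euc N × ℝ)).restrict (Sset N)), u z = 0 := by
  have hp0 : 0 < p := by linarith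
  have hq1 : 1 < q := (le_max_right _ _).trans_lt hq
  have hlq : p + m - 2 < q := (le_max_left _ _).trans_lt hq
  have hl0 : 0 < p + m - 2 := by linarith
  rw [show q - p - m + 2 = q - (p + m - 2) by ring] at hint hcond1 hcond2
  obtain ⟨R₁, -, hint⟩ := hint
  have ha := haLip.continuous.measurable
  have ha0 : ∀ x, 0 ≤ a x := by
    have hd : Dense {x | 0 < a x} := Measure.dense_of_ae haPos
    have hcl : IsClosed {x | 0 ≤ a x} := isClosed_le continuous_const haLip.continuous
    exact fun x => closure_minimal (fun y (hy : 0 < a y) => hy.le) hcl (hd x)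
  have hh' : ∀ᵐ x ∂(volume : Measure (Euc N)), 0 < h x ∧ h x ≤ C * (1 + ‖x‖) ^ α := by
    filter_upwards [hh] with x hx
    exact ⟨lt_of_lt_of_le (by positivity) hx.1, hx.2⟩
  have hpos : ∀ᵐ z ∂muS a, 0 < h z.1 := by
    refine (muS_absolutelyContinuous ha).ae_le (ae_restrict_of_ae ?_)
    exact Measure.quasiMeasurePreserving_fst.ae (hh'.mono fun x hx => hx.1)
  have hzero := hu.lintegral_reaction_eq_zero hp hm hK.le hf haLip ha0 hVpos hhmeas hVlow hC hα
    ((withDensity_absolutelyContinuous _ _).ae_le hh') hpos rfl hlq hq1 hσ1 hσ2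
    (sub_pos.2 hcond1) (add_sub_cancel _ _) hcond2
    (fun r hr => lintegral_rpow_neg_le_of_integral_le haLip.continuous hhmeas hC hα
      (div_nonneg zero_le_one (by linarith)) (hh.mono fun x hx => hx.1) (hint r hr).1)
    (fun r hr => lintegral_rpow_neg_le_of_integral_le haLip.continuous hhmeas hC hα
      (div_nonneg hl0.le (by linarith)) (hh.mono fun x hx => hx.1) (hint r hr).2)
  have hum := hu.aemeasurable ha
  rw [lintegral_eq_zero_iff' (by fun_prop)] at hzero
  have hae : ∀ᵐ z ∂muS a, z ∈ Sset N → u z = 0 := by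
    filter_upwards [hzero, hpos] with z hz hH hzS
    by_contra hne
    have hu0 : 0 < u z := lt_of_le_of_ne (hu.nonneg z hzS) (Ne.symm hne)
    exact (ENNReal.ofReal_pos.2 (show 0 < u z ^ q * h z.1 by positivity)).ne' hz
  rw [muS_eq_withDensity ha, ae_withDensity_iff (by fun_prop)] at hae
  filter_upwards [hae, ae_restrict_mem (isOpen_Sset N).measurableSet,
    ae_restrict_of_ae (Measure.quasiMeasurePreserving_fst.ae haPos)] with z h1 h2 h3
  exact h1 (ENNReal.ofReal_pos.2 h3).ne' h2

end
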